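/- arXiv:2204.01120 — 11 statements merged into one kernel-verified Lean document; each statement's English description precedes it below -/
import Mathlib

section
/- Fix n ≥ 1. The one-dimensional MinMaxP mechanism is strategyproof: for every profile P = (p_1, …, p_n) ∈ ℝⁿ, every prediction ô ∈ ℝ, every agent i ∈ {1,…,n}, and every misreport p'_i ∈ ℝ, we have |p_i − MinMaxP(P, ô)| ≤ |p_i − MinMaxP((P_{−i}, p'_i), ô)|, where (P_{−i}, p'_i) denotes the profile P with p_i replaced by p'_i. -/
/-- The MinMaxP mechanism on the line: the prediction clamped to [min_i p_i, max_i p_i]. -/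
noncomputable def minMaxP {n : ℕ} (P : Fin n → ℝ) (oh : ℝ) : ℝ :=
  max (⨅ i, P i) (min (⨆ i, P i) oh)

/-- An agent can lower the maximum report only by being the one who attains it. -/
lemma iSup_le_iSup_update_or_eq {n : ℕ} (P : Fin n → ℝ) (i : Fin n) (p' : ℝ) :
    (⨆ j, P j) ≤ (⨆ j, Function.update P i p' j) ∨ (⨆ j, P j) = P i := by
  have : Nonempty (Fin n) := ⟨i⟩
  obtain ⟨j, hj⟩ := exists_eq_ciSup_of_finite (f := P)
  rcases eq_or_ne j i with rfl | hji
  · exact Or.inr hj.symm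
  · left
    have h := le_ciSup (Set.finite_range (Function.update P i p')).bddAbove j
    rwa [Function.update_of_ne hji, hj] at h

/-- An agent can raise the minimum report only by being the one who attains it. -/
lemma iInf_update_le_iInf_or_eq {n : ℕ} (P : Fin n → ℝ) (i : Fin n) (p' : ℝ) :
    (⨅ j, Function.update P i p' j) ≤ (⨅ j, P j) ∨ (⨅ j, P j) = P i := by
  have : Nonempty (Fin n) := ⟨i⟩
  obtain ⟨j, hj⟩ := exists_eq_ciInf_of_finite (f := P)
  rcases eq_or_ne j i with rfl | hji
  · exact Or.inr hj.symm
  · left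
    have h := ciInf_le (Set.finite_range (Function.update P i p')).bddBelow j
    rwa [Function.update_of_ne hji, hj] at h

/-- Clamping is strategyproof for a peak `a ∈ [m, M]` that can move an endpoint of the interval
inwards only if it sits at that endpoint. -/
lemma abs_sub_clamp_le_abs_sub_clamp {a m M m' M' o : ℝ} (hm : m ≤ a) (hM : a ≤ M)
    (hm' : m' ≤ m ∨ m = a) (hM' : M ≤ M' ∨ M = a) :
    |a - max m (min M o)| ≤ |a - max m' (min M' o)| := by
  rcases le_total a o with hao | hoa
  · rw [max_eq_right (hm.trans (le_min hM hao)), abs_sub_comm a, abs_sub_comm a,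
      abs_of_nonneg (sub_nonneg.2 (le_min hM hao))]
    rcases hM' with h | rfl
    · refine le_trans (sub_le_sub_right ?_ a) (le_abs_self _)
      exact (min_le_min_right o h).trans (le_max_right _ _)
    · simp [hao]
  · rw [min_eq_right (hoa.trans hM), abs_of_nonneg (sub_nonneg.2 (max_le hm hoa))]
    rcases hm' with h | rfl
    · refine le_trans (sub_le_sub_left ?_ a) (le_abs_self _)
      exact max_le_max h (min_le_right _ _)
    · simp [hoa]

/-- the one-dimensional MinMaxP mechanism is strategyproof. -/
theorem minMaxP_strategyproof (n : ℕ) (hn : 1 ≤ n) (P : Fin n → ℝ) (oh : ℝ)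
    (i : Fin n) (p' : ℝ) :
    |P i - minMaxP P oh| ≤ |P i - minMaxP (Function.update P i p') oh| := by
  exact abs_sub_clamp_le_abs_sub_clamp
    (ciInf_le (Set.finite_range P).bddBelow i) (le_ciSup (Set.finite_range P).bddAbove i)
    (iInf_update_le_iInf_or_eq P i p') (iSup_le_iSup_update_or_eq P i p')
end

section
/- Fix n ≥ 1 and let P = (p_1, …, p_n) ∈ ℝⁿ. Then: (a) 1-consistency: for the optimal location o(P) = (min_i p_i + max_i p_i)/2 we have C^e(MinMaxP(P, o(P)), P) = OPT^e(P); and (b) 2-robustness: for every prediction ô ∈ ℝ, C^e(MinMaxP(P, ô), P) ≤ 2 · OPT^e(P). -/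
/-- The egalitarian social cost on the line. -/
noncomputable def Ce1 {n : ℕ} (y : ℝ) (P : Fin n → ℝ) : ℝ := ⨆ i, |y - P i|

/-- MinMaxP is 1-consistent and 2-robust for the egalitarian
objective on the line, where the optimal location is (min + max)/2 and the
optimal egalitarian cost is (max - min)/2. -/
theorem minMaxP_consistent_robust (n : ℕ) (hn : 1 ≤ n) (P : Fin n → ℝ) :
    Ce1 (minMaxP P (((⨅ i, P i) + (⨆ i, P i)) / 2)) P
        = ((⨆ i, P i) - (⨅ i, P i)) / 2 ∧
    ∀ oh : ℝ, Ce1 (minMaxP P oh) P ≤ 2 * (((⨆ i, P i) - (⨅ i, P i)) / 2) := by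
  have : Nonempty (Fin n) := ⟨⟨0, hn⟩⟩
  have hlo : ∀ i, (⨅ j, P j) ≤ P i := ciInf_le (Set.finite_range P).bddBelow
  have hhi : ∀ i, P i ≤ ⨆ j, P j := le_ciSup (Set.finite_range P).bddAbove
  obtain ⟨i₀, hi₀⟩ := exists_eq_ciInf_of_finite (f := P)
  have hle : (⨅ j, P j) ≤ ⨆ j, P j := (hlo i₀).trans (hhi i₀)
  unfold Ce1 minMaxP
  generalize (⨅ j, P j) = a at *
  generalize (⨆ j, P j) = b at *
  refine ⟨?_, fun oh => ciSup_le fun i => ?_⟩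
  · rw [min_eq_right (by linarith), max_eq_right (by linarith)]
    refine le_antisymm (ciSup_le fun i => ?_) ?_
    · rw [abs_le]
      constructor <;> linarith [hlo i, hhi i]
    · calc (b - a) / 2 = (a + b) / 2 - P i₀ := by rw [hi₀]; ring
        _ ≤ |(a + b) / 2 - P i₀| := le_abs_self _
        _ ≤ ⨆ i, |(a + b) / 2 - P i| :=
          le_ciSup (f := fun i => |(a + b) / 2 - P i|) (Set.finite_range _).bddAbove i₀
  · have h₁ : a ≤ max a (min b oh) := le_max_left _ _
    have h₂ : max a (min b oh) ≤ b := max_le hle (min_le_left _ _)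
    rw [abs_le]
    constructor <;> linarith [hlo i, hhi i]
end

section
/- Fix n ≥ 1. The Minimum Bounding Box mechanism is strategyproof: for every profile P ∈ (ℝ²)ⁿ, every prediction ô ∈ ℝ², every agent i ∈ {1,…,n}, and every misreport p'_i ∈ ℝ², we have ‖p_i − MBB(P, ô)‖ ≤ ‖p_i − MBB((P_{−i}, p'_i), ô)‖, where ‖·‖ is the Euclidean norm and (P_{−i}, p'_i) denotes the profile P with p_i replaced by p'_i. -/
/-- Euclidean distance on the plane. -/
noncomputable def eudist (a b : ℝ × ℝ) : ℝ :=
  Real.sqrt ((a.1 - b.1) ^ 2 + (a.2 - b.2) ^ 2)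

/-- Egalitarian social cost: the maximum distance from `y` to the points of `P`. -/
noncomputable def Ce {n : ℕ} (y : ℝ × ℝ) (P : Fin n → ℝ × ℝ) : ℝ :=
  ⨆ i, eudist y (P i)

/-- The Minimum Bounding Box mechanism: the prediction clamped coordinatewise to
the minimum axis-parallel bounding box of the reported points. -/
noncomputable def MBB {n : ℕ} (P : Fin n → ℝ × ℝ) (oh : ℝ × ℝ) : ℝ × ℝ :=
  (max (⨅ i, (P i).1) (min (⨆ i, (P i).1) oh.1),
   max (⨅ i, (P i).2) (min (⨆ i, (P i).2) oh.2))

/-- Clamping a prediction to the range of a finite family of reals is strategyproof: changing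
the value at `i` does not bring the outcome closer to the original value at `i`. -/
theorem abs_sub_clamp_range_le {ι : Type*} [Finite ι] (f g : ι → ℝ) (i : ι)
    (h : ∀ j, j ≠ i → g j = f j) (o : ℝ) :
    |f i - max (⨅ j, f j) (min (⨆ j, f j) o)| ≤ |f i - max (⨅ j, g j) (min (⨆ j, g j) o)| := by
  have : Nonempty ι := ⟨i⟩
  have hm : (⨅ j, f j) ≤ f i := ciInf_le (Set.finite_range f).bddBelow i
  have hM : f i ≤ ⨆ j, f j := le_ciSup (Set.finite_range f).bddAbove i
  have hm' : (⨅ j, f j) = f i ∨ (⨅ j, g j) ≤ ⨅ j, f j := by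
    obtain ⟨j, hj⟩ := exists_eq_ciInf_of_finite (f := f)
    by_cases hji : j = i
    · exact .inl (hji ▸ hj.symm)
    · exact .inr (hj ▸ h j hji ▸ ciInf_le (Set.finite_range g).bddBelow j)
  have hM' : (⨆ j, f j) = f i ∨ (⨆ j, f j) ≤ ⨆ j, g j := by
    obtain ⟨j, hj⟩ := exists_eq_ciSup_of_finite (f := f)
    by_cases hji : j = i
    · exact .inl (hji ▸ hj.symm)
    · exact .inr (hj ▸ h j hji ▸ le_ciSup (Set.finite_range g).bddAbove j)
  generalize (⨅ j, f j) = m, (⨆ j, f j) = M, (⨅ j, g j) = m', (⨆ j, g j) = M', f i = a at *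
  grind

/-- the Minimum Bounding Box mechanism is strategyproof. -/
theorem MBB_strategyproof (n : ℕ) (hn : 1 ≤ n) (P : Fin n → ℝ × ℝ) (oh : ℝ × ℝ)
    (i : Fin n) (p' : ℝ × ℝ) :
    eudist (P i) (MBB P oh) ≤ eudist (P i) (MBB (Function.update P i p') oh) := by
  apply Real.sqrt_le_sqrt
  refine add_le_add (sq_le_sq.mpr ?_) (sq_le_sq.mpr ?_)
  · exact abs_sub_clamp_range_le (fun j => (P j).1) (fun j => (Function.update P i p' j).1) i
      (fun j hj => by simp [hj]) oh.1
  · exact abs_sub_clamp_range_le (fun j => (P j).2) (fun j => (Function.update P i p' j).2) i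
      (fun j hj => by simp [hj]) oh.2
end

section
/- Fix n ≥ 1 and let P ∈ (ℝ²)ⁿ. If o(P) is the minimizer of the egalitarian social cost C^e(·, P) (the center of the minimum enclosing ball of P), then C^e(MBB(P, o(P)), P) = OPT^e(P); that is, the Minimum Bounding Box mechanism is 1-consistent for the egalitarian objective. -/
/-- Clamping to an interval does not increase the distance to a point of that interval. -/
theorem sq_clamp_sub_le {l u p x : ℝ} (hl : l ≤ p) (hu : p ≤ u) :
    (max l (min u x) - p) ^ 2 ≤ (x - p) ^ 2 := by
  refine sq_le_sq.mpr ?_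
  have h_max := abs_max_sub_max_le_max l (min u x) l p
  have h_min := abs_min_sub_min_le_max u x u p
  simp only [max_eq_right hl, min_eq_right hu, sub_self, abs_zero, abs_nonneg, sup_of_le_right]
    at h_max h_min
  exact h_max.trans h_min

/-- Clamping to the bounding box does not increase the distance to any reported point. -/
theorem eudist_MBB_le {n : ℕ} (P : Fin n → ℝ × ℝ) (o : ℝ × ℝ) (i : Fin n) :
    eudist (MBB P o) (P i) ≤ eudist o (P i) :=
  Real.sqrt_le_sqrt <| add_le_add
    (sq_clamp_sub_le (ciInf_le (Set.finite_range _).bddBelow i)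
      (le_ciSup (f := fun i => (P i).1) (Set.finite_range _).bddAbove i))
    (sq_clamp_sub_le (ciInf_le (Set.finite_range _).bddBelow i)
      (le_ciSup (f := fun i => (P i).2) (Set.finite_range _).bddAbove i))

/-- the Minimum Bounding Box mechanism is 1-consistent for the
egalitarian objective: with the correct prediction (the minimizer of the
egalitarian cost) it attains the optimal egalitarian social cost. -/
theorem MBB_one_consistent (n : ℕ) (hn : 1 ≤ n) (P : Fin n → ℝ × ℝ) (o : ℝ × ℝ)
    (ho : ∀ y : ℝ × ℝ, Ce o P ≤ Ce y P) :
    Ce (MBB P o) P = Ce o P := by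
  exact le_antisymm (ciSup_mono (Set.finite_range _).bddAbove (eudist_MBB_le P o)) (ho _)
end

section
/- Fix n ≥ 1 and let P ∈ (ℝ²)ⁿ. For every prediction ô ∈ ℝ², C^e(MBB(P, ô), P) ≤ (1 + √2) · OPT^e(P); that is, the Minimum Bounding Box mechanism is (1 + √2)-robust for the egalitarian objective. -/
theorem eudist_eq_dist (a b : ℝ × ℝ) :
    eudist a b = dist (!₂[a.1, a.2] : EuclideanSpace ℝ (Fin 2)) !₂[b.1, b.2] := by
  simp [eudist, EuclideanSpace.dist_eq, Real.dist_eq, sq_abs]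

theorem eudist_triangle (a b c : ℝ × ℝ) : eudist a c ≤ eudist a b + eudist b c := by
  simp only [eudist_eq_dist]
  exact dist_triangle _ _ _

theorem abs_fst_sub_le_eudist (a b : ℝ × ℝ) : |b.1 - a.1| ≤ eudist a b := by
  rw [abs_sub_comm]
  exact Real.abs_le_sqrt (le_add_of_nonneg_right (sq_nonneg _))

theorem abs_snd_sub_le_eudist (a b : ℝ × ℝ) : |b.2 - a.2| ≤ eudist a b := by
  rw [abs_sub_comm]
  exact Real.abs_le_sqrt (le_add_of_nonneg_left (sq_nonneg _))

theorem eudist_le_sqrt_two_mul {a b : ℝ × ℝ} {R : ℝ} (h₁ : |a.1 - b.1| ≤ R)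
    (h₂ : |a.2 - b.2| ≤ R) : eudist a b ≤ √2 * R := by
  have hR : 0 ≤ R := (abs_nonneg _).trans h₁
  refine Real.sqrt_le_iff.2 ⟨by positivity, ?_⟩
  rw [mul_pow, Real.sq_sqrt zero_le_two]
  linarith [sq_le_sq' (abs_le.1 h₁).1 (abs_le.1 h₁).2,
    sq_le_sq' (abs_le.1 h₂).1 (abs_le.1 h₂).2]

theorem eudist_le_Ce {n : ℕ} (y : ℝ × ℝ) (P : Fin n → ℝ × ℝ) (i : Fin n) :
    eudist y (P i) ≤ Ce y P :=
  le_ciSup (f := fun i => eudist y (P i)) (Set.finite_range _).bddAbove i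

/-- Clamping to the range of a finite family stays in every interval containing the family. -/
theorem abs_clamp_sub_le {ι : Type*} [Finite ι] [Nonempty ι] {f : ι → ℝ} {c R : ℝ}
    (h : ∀ i, |f i - c| ≤ R) (t : ℝ) : |max (⨅ i, f i) (min (⨆ i, f i) t) - c| ≤ R := by
  obtain ⟨i⟩ := ‹Nonempty ι›
  have hi : ⨅ i, f i ≤ f i := ciInf_le (Set.finite_range f).bddBelow i
  have lower : c - R ≤ ⨅ i, f i := le_ciInf fun j => by linarith [(abs_le.1 (h j)).1]
  have upper : ⨆ i, f i ≤ c + R := ciSup_le fun j => by linarith [(abs_le.1 (h j)).2]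
  have clamp_lower : c - R ≤ max (⨅ i, f i) (min (⨆ i, f i) t) := lower.trans (le_max_left _ _)
  have clamp_upper : max (⨅ i, f i) (min (⨆ i, f i) t) ≤ c + R :=
    max_le (by linarith [(abs_le.1 (h i)).2]) ((min_le_left _ _).trans upper)
  exact abs_le.2 ⟨by linarith, by linarith⟩

/-- the Minimum Bounding Box mechanism is (1 + √2)-robust for the
egalitarian objective. -/
theorem MBB_robust (n : ℕ) (hn : 1 ≤ n) (P : Fin n → ℝ × ℝ) (oh : ℝ × ℝ) :
    Ce (MBB P oh) P ≤ (1 + Real.sqrt 2) * ⨅ y : ℝ × ℝ, Ce y P := by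
  have : Nonempty (Fin n) := ⟨⟨0, hn⟩⟩
  rw [Real.mul_iInf_of_nonneg (by positivity)]
  refine le_ciInf fun y => ciSup_le fun i => ?_
  have hm : eudist (MBB P oh) y ≤ √2 * Ce y P :=
    eudist_le_sqrt_two_mul
      (abs_clamp_sub_le (fun j => (abs_fst_sub_le_eudist y (P j)).trans (eudist_le_Ce y P j)) _)
      (abs_clamp_sub_le (fun j => (abs_snd_sub_le_eudist y (P j)).trans (eudist_le_Ce y P j)) _)
  linarith [eudist_triangle (MBB P oh) y (P i), eudist_le_Ce y P i]
end

section
/- Fix n ≥ 1 and c ∈ [0,1) with cn ∈ ℕ. The Coordinatewise Median with Predictions mechanism is strategyproof: for every profile P ∈ (ℝ²)ⁿ, every prediction ô ∈ ℝ², every agent i ∈ {1,…,n}, and every misreport p'_i ∈ ℝ², we have ‖p_i − CMP(P, ô, c)‖ ≤ ‖p_i − CMP((P_{−i}, p'_i), ô, c)‖, where ‖·‖ is the Euclidean norm and (P_{−i}, p'_i) denotes the profile P with p_i replaced by p'_i. -/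
/-- Utilitarian social cost: the average distance from `y` to the points of `P`. -/
noncomputable def Cu {n : ℕ} (y : ℝ × ℝ) (P : Fin n → ℝ × ℝ) : ℝ :=
  (∑ i, eudist y (P i)) / n

/-- The lower median of a multiset of `m` reals: its `⌈m/2⌉`-th smallest element. -/
noncomputable def lowerMedian (s : Multiset ℝ) : ℝ :=
  (s.sort (· ≤ ·)).getD ((s.card + 1) / 2 - 1) 0

/-- The Coordinatewise Median with Predictions mechanism: the coordinatewise
lower median of the reported points together with `k` copies of the
prediction (where `k = c·n` for confidence `c`). -/
noncomputable def CMP {n : ℕ} (P : Fin n → ℝ × ℝ) (oh : ℝ × ℝ) (k : ℕ) : ℝ × ℝ :=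
  (lowerMedian ((↑(List.ofFn fun i => (P i).1) : Multiset ℝ) + Multiset.replicate k oh.1),
   lowerMedian ((↑(List.ofFn fun i => (P i).2) : Multiset ℝ) + Multiset.replicate k oh.2))

theorem List.getElem_le_iff_lt_countP {α : Type*} [LinearOrder α] {l : List α}
    (hl : l.Pairwise (· ≤ ·)) (x : α) {r : ℕ} (hr : r < l.length) :
    l[r] ≤ x ↔ r < l.countP (· ≤ x) := by
  induction l generalizing r with
  | nil => simp at hr
  | cons a l ih =>
    obtain ⟨ha, hl⟩ := List.pairwise_cons.1 hl
    by_cases hax : a ≤ x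
    · cases r with
      | zero => simp [hax]
      | succ r =>
        have hr' : r < l.length := by simpa using hr
        simpa [hax] using ih hl hr'
    · have hcount : (a :: l).countP (· ≤ x) = 0 := by
        rw [List.countP_eq_zero]
        intro b hb
        rcases List.mem_cons.1 hb with rfl | hb
        · simpa using hax
        · simpa using (not_le.1 hax).trans_le (ha b hb)
      have hle : a ≤ (a :: l)[r] := by
        rcases List.mem_cons.1 (List.getElem_mem hr) with h | h
        · exact h.ge
        · exact ha _ h
      rw [hcount]
      simpa using (not_le.1 hax).trans_le hle

theorem lowerMedian_le_iff {s : Multiset ℝ} (hs : 0 < s.card) (x : ℝ) :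
    lowerMedian s ≤ x ↔ (s.card + 1) / 2 ≤ s.countP (· ≤ x) := by
  have hr : (s.card + 1) / 2 - 1 < (s.sort (· ≤ ·)).length := by
    rw [Multiset.length_sort]
    omega
  have hcount : (s.sort (· ≤ ·)).countP (· ≤ x) = s.countP (· ≤ x) := by
    rw [← Multiset.coe_countP, Multiset.sort_eq]
  rw [lowerMedian, List.getD_eq_getElem _ _ hr,
    List.getElem_le_iff_lt_countP (Multiset.pairwise_sort s (· ≤ ·)) x hr, hcount]
  omega

/-- The lower median is strategyproof on the line: replacing `a` by `b` cannot bring it closer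
to `a`. -/
theorem abs_sub_lowerMedian_cons_le (a b : ℝ) (t : Multiset ℝ) :
    |a - lowerMedian (a ::ₘ t)| ≤ |a - lowerMedian (b ::ₘ t)| := by
  have ha := lowerMedian_le_iff (s := a ::ₘ t) (by simp)
  have hb := lowerMedian_le_iff (s := b ::ₘ t) (by simp)
  simp only [Multiset.card_cons, Multiset.countP_cons] at ha hb
  generalize lowerMedian (a ::ₘ t) = m at *
  generalize lowerMedian (b ::ₘ t) = m' at *
  rcases lt_trichotomy a m with h | rfl | h
  · have hmm : m ≤ m' := by
      by_contra! hlt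
      rcases le_or_gt a m' with h' | h'
      · have h1 := (hb m').1 le_rfl
        refine hlt.not_ge ((ha m').2 ?_)
        rw [if_pos h']
        split_ifs at h1 <;> omega
      · have h1 := (hb m').1 le_rfl
        have h2 : t.countP (· ≤ m') ≤ t.countP (· ≤ a) := by
          simp only [Multiset.countP_eq_card_filter]
          exact Multiset.card_le_card
            (Multiset.monotone_filter_right t fun y hy => hy.trans h'.le)
        refine h.not_ge ((ha a).2 ?_)
        rw [if_pos le_rfl]
        split_ifs at h1 <;> omega
    rw [abs_of_neg (by linarith), abs_of_neg (by linarith)]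
    linarith
  · simp
  · have hmm : m' ≤ m := by
      have h1 := (ha m).1 le_rfl
      rw [if_neg h.not_ge] at h1
      exact (hb m).2 (by omega)
    rw [abs_of_pos (by linarith), abs_of_pos (by linarith)]
    linarith

theorem Multiset.coe_ofFn_eq_cons {α : Type*} {n : ℕ} (f : Fin n → α) (i : Fin n) :
    (↑(List.ofFn f) : Multiset α) = f i ::ₘ (Finset.univ.erase i).val.map f := by
  rw [← Fin.univ_val_map, ← Multiset.map_cons, Finset.erase_val,
    Multiset.cons_erase (Finset.mem_univ_val i)]

theorem abs_sub_lowerMedian_ofFn_le {n : ℕ} {f g : Fin n → ℝ} (i : Fin n)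
    (hfg : ∀ j ≠ i, g j = f j) (u : Multiset ℝ) :
    |f i - lowerMedian (↑(List.ofFn f) + u)| ≤ |f i - lowerMedian (↑(List.ofFn g) + u)| := by
  have hmap : (Finset.univ.erase i).val.map g = (Finset.univ.erase i).val.map f :=
    Multiset.map_congr rfl fun j hj => hfg j (Finset.ne_of_mem_erase (Finset.mem_def.2 hj))
  rw [Multiset.coe_ofFn_eq_cons f i, Multiset.coe_ofFn_eq_cons g i, hmap,
    Multiset.cons_add, Multiset.cons_add]
  exact abs_sub_lowerMedian_cons_le _ _ _

/-- the Coordinatewise Median with Predictions mechanism is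
strategyproof. -/
theorem CMP_strategyproof (n : ℕ) (hn : 1 ≤ n) (c : ℝ) (hc0 : 0 ≤ c) (hc1 : c < 1)
    (k : ℕ) (hk : (k : ℝ) = c * n)
    (P : Fin n → ℝ × ℝ) (oh : ℝ × ℝ) (i : Fin n) (p' : ℝ × ℝ) :
    eudist (P i) (CMP P oh k) ≤ eudist (P i) (CMP (Function.update P i p') oh k) := by
  refine Real.sqrt_le_sqrt (add_le_add (sq_le_sq.2 ?_) (sq_le_sq.2 ?_))
  · exact abs_sub_lowerMedian_ofFn_le (f := fun j => (P j).1) i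
      (fun j hj => by simp [Function.update_of_ne hj]) _
  · exact abs_sub_lowerMedian_ofFn_le (f := fun j => (P j).2) i
      (fun j hj => by simp [Function.update_of_ne hj]) _
end

section
/- Fix n ≥ 1 and c ∈ [0,1) with cn ∈ ℕ. For every profile P ∈ (ℝ²)ⁿ and every minimizer o of the utilitarian social cost C^u(·, P), the Coordinatewise Median with Predictions mechanism given the correct prediction satisfies C^u(CMP(P, o, c), P) ≤ (√(2c² + 2) / (1 + c)) · OPT^u(P); that is, CMP with confidence c is √(2c² + 2)/(1 + c)-consistent for the utilitarian objective. -/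
/-- At least half of the elements of a multiset are at least its lower median. -/
theorem card_le_two_mul_countP_lowerMedian_le (s : Multiset ℝ) :
    s.card ≤ 2 * s.countP (lowerMedian s ≤ ·) := by
  rcases Nat.eq_zero_or_pos s.card with h | h
  · omega
  have hlen : (s.sort (· ≤ ·)).length = s.card := Multiset.length_sort _
  have hs : ((s.sort (· ≤ ·) : List ℝ) : Multiset ℝ) = s := Multiset.sort_eq _ _
  have hsorted : (s.sort (· ≤ ·)).Pairwise (· ≤ ·) := Multiset.pairwise_sort _ _
  have hm : lowerMedian s = (s.sort (· ≤ ·)).getD ((s.card + 1) / 2 - 1) 0 := rfl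
  generalize lowerMedian s = m at *
  generalize s.sort (· ≤ ·) = l at *
  set j := (s.card + 1) / 2 - 1 with hj
  have hjl : j < l.length := by omega
  rw [List.getD_eq_getElem _ _ hjl] at hm
  have hc : s.countP (m ≤ ·) = l.countP (m ≤ ·) := by rw [← hs, Multiset.coe_countP]
  have hdrop : (l.drop j).countP (m ≤ ·) = (l.drop j).length := by
    rw [List.countP_eq_length]
    intro x hx
    obtain ⟨i, hi, rfl⟩ := List.mem_iff_getElem.mp hx
    rw [List.getElem_drop]
    simp only [decide_eq_true_eq, hm]
    exact hsorted.sortedLE.getElem_le_getElem_of_le (by omega)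
  have hle : (l.drop j).countP (m ≤ ·) ≤ l.countP (m ≤ ·) :=
    (List.drop_sublist j l).countP_le
  rw [hdrop, List.length_drop] at hle
  omega

/-- At least half of the elements of a multiset are at most its lower median. -/
theorem card_le_two_mul_countP_le_lowerMedian (s : Multiset ℝ) :
    s.card ≤ 2 * s.countP (· ≤ lowerMedian s) := by
  rcases Nat.eq_zero_or_pos s.card with h | h
  · omega
  have hlen : (s.sort (· ≤ ·)).length = s.card := Multiset.length_sort _
  have hs : ((s.sort (· ≤ ·) : List ℝ) : Multiset ℝ) = s := Multiset.sort_eq _ _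
  have hsorted : (s.sort (· ≤ ·)).Pairwise (· ≤ ·) := Multiset.pairwise_sort _ _
  have hm : lowerMedian s = (s.sort (· ≤ ·)).getD ((s.card + 1) / 2 - 1) 0 := rfl
  generalize lowerMedian s = m at *
  generalize s.sort (· ≤ ·) = l at *
  set j := (s.card + 1) / 2 - 1 with hj
  have hjl : j < l.length := by omega
  rw [List.getD_eq_getElem _ _ hjl] at hm
  have hc : s.countP (· ≤ m) = l.countP (· ≤ m) := by rw [← hs, Multiset.coe_countP]
  have htake : (l.take (j + 1)).countP (· ≤ m) = (l.take (j + 1)).length := by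
    rw [List.countP_eq_length]
    intro x hx
    obtain ⟨i, hi, rfl⟩ := List.mem_iff_getElem.mp hx
    rw [List.getElem_take]
    rw [List.length_take] at hi
    simp only [decide_eq_true_eq, hm]
    exact hsorted.sortedLE.getElem_le_getElem_of_le (by omega)
  have hle : (l.take (j + 1)).countP (· ≤ m) ≤ l.countP (· ≤ m) :=
    (List.take_sublist (j + 1) l).countP_le
  rw [htake, List.length_take] at hle
  omega

theorem countP_ofFn_add_replicate {n : ℕ} (x : Fin n → ℝ) (k : ℕ) (o : ℝ) (p : ℝ → Prop)
    [DecidablePred p] (ho : ¬ p o) :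
    ((↑(List.ofFn x) : Multiset ℝ) + Multiset.replicate k o).countP p
      = (Finset.univ.filter fun i => p (x i)).card := by
  rw [Multiset.countP_add, ← Fin.univ_val_map, Multiset.countP_map]
  have : (Multiset.replicate k o).countP p = 0 := by
    rw [Multiset.countP_eq_zero]
    intro a ha
    rw [Multiset.eq_of_mem_replicate ha]
    exact ho
  rw [this, add_zero]
  rfl

/-- If adding `k` copies of `o` moves the lower median away from `o`, then at least `(n + k) / 2` of
the `n` original values lie on the far side of that median. -/
theorem exists_sign_lowerMedian_count {n : ℕ} (x : Fin n → ℝ) (k : ℕ) (o : ℝ) (m : ℝ)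
    (hm : m = lowerMedian ((↑(List.ofFn x) : Multiset ℝ) + Multiset.replicate k o)) :
    ∃ ε : ℝ, ε ^ 2 = 1 ∧ 0 ≤ ε * (m - o) ∧
      ε * (m - o) * ((n : ℝ) + k) ≤ ε * (m - o) *
        (2 * (Finset.univ.filter fun i => ε * (m - o) ≤ ε * (x i - o)).card) := by
  have hcard : ((↑(List.ofFn x) : Multiset ℝ) + Multiset.replicate k o).card = n + k := by
    simp
  rcases lt_trichotomy o m with h | h | h
  · refine ⟨1, by norm_num, by linarith, mul_le_mul_of_nonneg_left ?_ (by linarith)⟩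
    have h1 := card_le_two_mul_countP_lowerMedian_le
      ((↑(List.ofFn x) : Multiset ℝ) + Multiset.replicate k o)
    rw [← hm, hcard, countP_ofFn_add_replicate x k o (m ≤ ·) (not_le.mpr h)] at h1
    have h2 : (Finset.univ.filter fun i => (1 : ℝ) * (m - o) ≤ 1 * (x i - o))
        = Finset.univ.filter fun i => m ≤ x i := by
      ext i; simp
    rw [h2]
    exact_mod_cast h1
  · exact ⟨1, by norm_num, by simp [h], by simp [h]⟩
  · refine ⟨-1, by norm_num, by linarith, mul_le_mul_of_nonneg_left ?_ (by linarith)⟩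
    have h1 := card_le_two_mul_countP_le_lowerMedian
      ((↑(List.ofFn x) : Multiset ℝ) + Multiset.replicate k o)
    rw [← hm, hcard, countP_ofFn_add_replicate x k o (· ≤ m) (not_le.mpr h)] at h1
    have h2 : (Finset.univ.filter fun i => (-1 : ℝ) * (m - o) ≤ -1 * (x i - o))
        = Finset.univ.filter fun i => x i ≤ m := by
      ext i; simp only [Finset.mem_filter, Finset.mem_univ, true_and]; constructor <;> intro <;> linarith
    rw [h2]
    exact_mod_cast h1

theorem sqrt_add_sq_le_add {x y u v b : ℝ} (hb : 0 ≤ b) (h : (x - u) ^ 2 + (y - v) ^ 2 ≤ b ^ 2) :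
    √(x ^ 2 + y ^ 2) ≤ √(u ^ 2 + v ^ 2) + b := by
  have hr := Real.sqrt_nonneg (u ^ 2 + v ^ 2)
  have hr2 := Real.sq_sqrt (show 0 ≤ u ^ 2 + v ^ 2 by positivity)
  set r := √(u ^ 2 + v ^ 2)
  refine Real.sqrt_le_iff.mpr ⟨by linarith, ?_⟩
  have key : (x - u) * u + (y - v) * v ≤ b * r := by
    refine abs_le_of_sq_le_sq' ?_ (by positivity) |>.2
    nlinarith [sq_nonneg ((x - u) * v - (y - v) * u), mul_le_mul_of_nonneg_right h (sq_nonneg r)]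
  nlinarith

theorem one_le_of_sq_eq {l κ : ℝ} (hl : 0 ≤ l) (hlκ : l ^ 2 = 1 + κ ^ 2) : 1 ≤ l := by
  nlinarith [sq_nonneg κ]

/-- Points beyond the median in one coordinate. -/
theorem sqrt_sub_sq_le_of_le_left {l κ a b x y : ℝ} (hl : 0 ≤ l) (hlκ : l ^ 2 = 1 + κ ^ 2)
    (ha : 0 ≤ a) (hb : 0 ≤ b) (hx : a ≤ x) :
    √((x - a) ^ 2 + (y - b) ^ 2) + κ * a ≤ l * √(x ^ 2 + y ^ 2) + b := by
  have h1 : √((x - a) ^ 2 + (y - b) ^ 2) ≤ √((x - a) ^ 2 + y ^ 2) + b :=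
    sqrt_add_sq_le_add hb (by nlinarith)
  have hr := Real.sqrt_nonneg ((x - a) ^ 2 + y ^ 2)
  have hr2 := Real.sq_sqrt (show 0 ≤ (x - a) ^ 2 + y ^ 2 by positivity)
  set r := √((x - a) ^ 2 + y ^ 2)
  have ht := Real.sqrt_nonneg (x ^ 2 + y ^ 2)
  have ht2 := Real.sq_sqrt (show 0 ≤ x ^ 2 + y ^ 2 by positivity)
  set t := √(x ^ 2 + y ^ 2)
  have h2 : a ^ 2 + r ^ 2 ≤ t ^ 2 := by
    nlinarith [mul_nonneg ha (sub_nonneg.mpr hx)]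
  have h3 : r + κ * a ≤ l * t := by
    refine abs_le_of_sq_le_sq' ?_ (by positivity) |>.2
    rw [mul_pow, hlκ]
    nlinarith [sq_nonneg (κ * r - a), mul_le_mul_of_nonneg_left h2 (show 0 ≤ 1 + κ ^ 2 by positivity)]
  linarith

/-- Points beyond the median in both coordinates. -/
theorem sqrt_sub_sq_le_of_le_of_le {l κ a b x y : ℝ} (hl : 0 ≤ l) (hlκ : l ^ 2 = 1 + κ ^ 2)
    (hκ0 : 0 ≤ κ) (hκ1 : κ ≤ 1) (hb : 0 ≤ b) (hab : b ≤ a) (hx : a ≤ x) (hy : b ≤ y) :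
    √((x - a) ^ 2 + (y - b) ^ 2) + κ * (a + b) ≤ l * √(x ^ 2 + y ^ 2) := by
  obtain ⟨q, rfl⟩ : ∃ q, x = a + q := ⟨x - a, by ring⟩
  obtain ⟨w, rfl⟩ : ∃ w, y = b + w := ⟨y - b, by ring⟩
  have hq : 0 ≤ q := by linarith
  have hw : 0 ≤ w := by linarith
  have ha : 0 ≤ a := by linarith
  rw [add_sub_cancel_left, add_sub_cancel_left]
  have hr := Real.sqrt_nonneg (q ^ 2 + w ^ 2)
  have hr2 := Real.sq_sqrt (show 0 ≤ q ^ 2 + w ^ 2 by positivity)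
  set r := √(q ^ 2 + w ^ 2)
  have ht := Real.sqrt_nonneg ((a + q) ^ 2 + (b + w) ^ 2)
  have ht2 := Real.sq_sqrt (show 0 ≤ (a + q) ^ 2 + (b + w) ^ 2 by positivity)
  set t := √((a + q) ^ 2 + (b + w) ^ 2)
  refine abs_le_of_sq_le_sq' ?_ (by positivity) |>.2
  rw [mul_pow, hlκ, ht2]
  have hrqw : r ≤ q + w := abs_le_of_sq_le_sq' (by nlinarith) (by positivity) |>.2
  have hin : b * r ≤ a * q + b * w := by
    nlinarith [mul_le_mul_of_nonneg_left hrqw hb, mul_le_mul_of_nonneg_right hab hq]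
  have hquad : 0 ≤ (a - κ * r) ^ 2 + b ^ 2 - 2 * κ ^ 2 * b * (a - κ * r) := by
    have hk4 : (κ ^ 2) ^ 2 ≤ 1 := by
      have : κ ^ 2 ≤ 1 := by nlinarith
      nlinarith [sq_nonneg κ]
    nlinarith [sq_nonneg (a - κ * r - κ ^ 2 * b), mul_nonneg (sub_nonneg.mpr hk4) (sq_nonneg b)]
  have hrest : 0 ≤ b * r * ((1 - κ) * (1 + κ ^ 2)) :=
    mul_nonneg (mul_nonneg hb hr) (mul_nonneg (by linarith) (by positivity))
  have hin' := mul_le_mul_of_nonneg_left hin (show 0 ≤ 2 * (1 + κ ^ 2) by positivity)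
  have hsplit : (1 + κ ^ 2) * ((a + q) ^ 2 + (b + w) ^ 2)
      = (1 + κ ^ 2) * (a ^ 2 + b ^ 2 + r ^ 2) + 2 * (1 + κ ^ 2) * (a * q + b * w) := by
    rw [hr2]; ring
  rw [hsplit]
  nlinarith

/-- The pointwise inequality behind the consistency bound: moving from the origin to a point
`(a, b)` of the first quadrant is paid for by the points beyond `a` and beyond `b`. -/
theorem sqrt_sub_sq_add_indicator_le {l κ a b x y : ℝ} (hl : 0 ≤ l) (hlκ : l ^ 2 = 1 + κ ^ 2)
    (hκ0 : 0 ≤ κ) (hκ1 : κ ≤ 1) (ha : 0 ≤ a) (hb : 0 ≤ b) :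
    √((x - a) ^ 2 + (y - b) ^ 2)
        + (1 + κ) * ((if a ≤ x then a else 0) + (if b ≤ y then b else 0))
      ≤ l * √(x ^ 2 + y ^ 2) + (a + b) := by
  by_cases hx : a ≤ x <;> by_cases hy : b ≤ y <;> simp only [hx, hy, if_true, if_false]
  · rcases le_total b a with h | h
    · linarith [sqrt_sub_sq_le_of_le_of_le hl hlκ hκ0 hκ1 hb h hx hy]
    · have := sqrt_sub_sq_le_of_le_of_le hl hlκ hκ0 hκ1 ha h hy hx
      rw [add_comm ((y - b) ^ 2), add_comm (y ^ 2)] at this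
      linarith
  · linarith [sqrt_sub_sq_le_of_le_left (y := y) hl hlκ ha hb hx]
  · have := sqrt_sub_sq_le_of_le_left (y := x) hl hlκ hb ha hy
    rw [add_comm ((y - b) ^ 2), add_comm (y ^ 2)] at this
    linarith
  · have h1 : √((x - a) ^ 2 + (y - b) ^ 2) ≤ √(x ^ 2 + y ^ 2) + (a + b) :=
      sqrt_add_sq_le_add (by positivity) (by nlinarith [mul_nonneg ha hb])
    have h2 := mul_le_mul_of_nonneg_right (one_le_of_sq_eq hl hlκ) (Real.sqrt_nonneg (x ^ 2 + y ^ 2))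
    linarith

/-- CMP with confidence c is √(2c² + 2)/(1 + c)-consistent for the
utilitarian objective. -/
theorem CMP_consistency (n : ℕ) (hn : 1 ≤ n) (c : ℝ) (hc0 : 0 ≤ c) (hc1 : c < 1)
    (k : ℕ) (hk : (k : ℝ) = c * n)
    (P : Fin n → ℝ × ℝ) (o : ℝ × ℝ) (ho : ∀ y : ℝ × ℝ, Cu o P ≤ Cu y P) :
    Cu (CMP P o k) P ≤ (Real.sqrt (2 * c ^ 2 + 2) / (1 + c)) * Cu o P := by
  obtain ⟨ε, hε, ha, hA⟩ :=
    exists_sign_lowerMedian_count (fun i => (P i).1) k o.1 (CMP P o k).1 rfl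
  obtain ⟨δ, hδ, hb, hB⟩ :=
    exists_sign_lowerMedian_count (fun i => (P i).2) k o.2 (CMP P o k).2 rfl
  set m := CMP P o k
  set a := ε * (m.1 - o.1) with ha_def
  set b := δ * (m.2 - o.2) with hb_def
  set l := Real.sqrt (2 * c ^ 2 + 2) / (1 + c) with hl_def
  have hc : 0 < 1 + c := by linarith
  set κ := (1 - c) / (1 + c) with hκ_def
  have hl : 0 ≤ l := by positivity
  have hκ0 : 0 ≤ κ := div_nonneg (by linarith) hc.le
  have hκ1 : κ ≤ 1 := (div_le_one hc).mpr (by linarith)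
  have hlκ : l ^ 2 = 1 + κ ^ 2 := by
    rw [hl_def, hκ_def, div_pow, Real.sq_sqrt (by positivity)]
    field_simp
    ring
  have hκ : (1 + κ) * (1 + c) = 2 := by
    rw [hκ_def]
    field_simp
    ring
  have point : ∀ i, eudist m (P i)
      + (1 + κ) * ((if a ≤ ε * ((P i).1 - o.1) then a else 0)
        + (if b ≤ δ * ((P i).2 - o.2) then b else 0)) ≤ l * eudist o (P i) + (a + b) := by
    intro i
    have h := sqrt_sub_sq_add_indicator_le (x := ε * ((P i).1 - o.1)) (y := δ * ((P i).2 - o.2))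
      hl hlκ hκ0 hκ1 ha hb
    have h1 : eudist m (P i) = √((ε * ((P i).1 - o.1) - a) ^ 2 + (δ * ((P i).2 - o.2) - b) ^ 2) := by
      rw [eudist, ha_def, hb_def, ← mul_sub, ← mul_sub, mul_pow, mul_pow, hε, hδ]
      congr 1; ring
    have h2 : eudist o (P i) = √((ε * ((P i).1 - o.1)) ^ 2 + (δ * ((P i).2 - o.2)) ^ 2) := by
      rw [eudist, mul_pow, mul_pow, hε, hδ]
      congr 1; ring
    rw [h1, h2]
    exact h
  have total := Finset.sum_le_sum fun i (_ : i ∈ Finset.univ) => point i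
  simp only [Finset.sum_add_distrib, ← Finset.mul_sum, ← Finset.sum_filter, Finset.sum_const,
    nsmul_eq_mul, Finset.card_univ, Fintype.card_fin] at total
  rw [hk] at hA hB
  have hA' : (n : ℝ) * a ≤ (1 + κ) *
      ((Finset.univ.filter fun i => a ≤ ε * ((P i).1 - o.1)).card * a) := by
    refine le_of_mul_le_mul_right ?_ hc
    linear_combination hA
      - a * (Finset.univ.filter fun i => a ≤ ε * ((P i).1 - o.1)).card * hκ
  have hB' : (n : ℝ) * b ≤ (1 + κ) *
      ((Finset.univ.filter fun i => b ≤ δ * ((P i).2 - o.2)).card * b) := by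
    refine le_of_mul_le_mul_right ?_ hc
    linear_combination hB
      - b * (Finset.univ.filter fun i => b ≤ δ * ((P i).2 - o.2)).card * hκ
  have final : ∑ i, eudist m (P i) ≤ l * ∑ i, eudist o (P i) := by linarith
  rw [Cu, Cu, mul_div_assoc']
  exact div_le_div_of_nonneg_right final (Nat.cast_nonneg n)
end

section
/- Fix n ≥ 1 and c ∈ [0,1) with cn ∈ ℕ. For every profile P ∈ (ℝ²)ⁿ and every prediction ô ∈ ℝ², the Coordinatewise Median with Predictions mechanism satisfies C^u(CMP(P, ô, c), P) ≤ (√(2c² + 2) / (1 − c)) · OPT^u(P); that is, CMP with confidence c is √(2c² + 2)/(1 − c)-robust for the utilitarian objective. -/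
theorem Real.mul_add_le_sqrt_mul_sqrt (S x y : ℝ) :
    S * x + y ≤ √(1 + S ^ 2) * √(x ^ 2 + y ^ 2) := by
  rw [← Real.sqrt_mul (by positivity)]
  apply Real.le_sqrt_of_sq_le
  nlinarith [sq_nonneg (x - S * y)]

theorem Real.sqrt_sq_add_sq_le_abs_add_abs (x y : ℝ) : √(x ^ 2 + y ^ 2) ≤ |x| + |y| := by
  rw [Real.sqrt_le_left (by positivity)]
  nlinarith [sq_abs x, sq_abs y, mul_nonneg (abs_nonneg x) (abs_nonneg y)]

theorem Real.sqrt_sq_add_sq_le_add (u v a b : ℝ) :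
    √(u ^ 2 + v ^ 2) ≤ √((u - a) ^ 2 + (v - b) ^ 2) + √(a ^ 2 + b ^ 2) := by
  rw [Real.sqrt_le_left (by positivity)]
  have h : (u - a) * a + (v - b) * b ≤ √((u - a) ^ 2 + (v - b) ^ 2) * √(a ^ 2 + b ^ 2) := by
    rw [← Real.sqrt_mul (by positivity)]
    apply Real.le_sqrt_of_sq_le
    nlinarith [sq_nonneg ((u - a) * b - (v - b) * a)]
  have h1 := Real.sq_sqrt (show 0 ≤ (u - a) ^ 2 + (v - b) ^ 2 by positivity)
  have h2 := Real.sq_sqrt (show 0 ≤ a ^ 2 + b ^ 2 by positivity)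
  nlinarith

/-- Halfplane bound: a point with nonpositive first coordinate is far from `(a, b)`. -/
theorem norm_le_of_fst_nonpos {S u v : ℝ} (a b : ℝ) (hS : 1 ≤ S) (hu : u ≤ 0) (hv : 0 ≤ v) :
    √(u ^ 2 + v ^ 2) ≤ √(1 + S ^ 2) * √((u - a) ^ 2 + (v - b) ^ 2) + (b - S * a) := by
  have h1 := Real.mul_add_le_sqrt_mul_sqrt S (a - u) (v - b)
  rw [sub_sq_comm a u] at h1
  have h2 := Real.sqrt_sq_add_sq_le_abs_add_abs u v
  rw [abs_of_nonpos hu, abs_of_nonneg hv] at h2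
  nlinarith

/-- Quadrant bound: a point of the opposite quadrant is far from `(a, b)`. -/
theorem norm_le_of_nonpos {S u v a b : ℝ} (hu : u ≤ 0) (hv : v ≤ 0)
    (ha : 0 ≤ a) (hb : 0 ≤ b) :
    √(u ^ 2 + v ^ 2) ≤
      √(1 + S ^ 2) * √((u - a) ^ 2 + (v - b) ^ 2) - S * √(a ^ 2 + b ^ 2) := by
  have h1 := Real.mul_add_le_sqrt_mul_sqrt S √(a ^ 2 + b ^ 2) √(u ^ 2 + v ^ 2)
  rw [Real.sq_sqrt (by positivity), Real.sq_sqrt (by positivity)] at h1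
  have h2 : √(a ^ 2 + b ^ 2 + (u ^ 2 + v ^ 2)) ≤ √((u - a) ^ 2 + (v - b) ^ 2) := by
    apply Real.sqrt_le_sqrt
    nlinarith [mul_nonneg (neg_nonneg.2 hu) ha, mul_nonneg (neg_nonneg.2 hv) hb]
  have h3 := mul_le_mul_of_nonneg_left h2 (Real.sqrt_nonneg (1 + S ^ 2))
  linarith

/-- Comparison of the total distances to the origin and to a point `(a, b)` of the first quadrant,
when a proportion at least `1 / (S + 1)` of the points lies in each of the halfplanes `u ≤ 0`
and `v ≤ 0`. -/
theorem sum_norm_le_of_card_nonpos {ι : Type*} [Fintype ι] {S : ℝ} (hS : 1 ≤ S) (u v : ι → ℝ)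
    {a b : ℝ} (ha : 0 ≤ a) (hb : 0 ≤ b)
    (hu : (Fintype.card ι : ℝ) ≤ (S + 1) * (Finset.univ.filter fun i => u i ≤ 0).card)
    (hv : (Fintype.card ι : ℝ) ≤ (S + 1) * (Finset.univ.filter fun i => v i ≤ 0).card) :
    ∑ i, √(u i ^ 2 + v i ^ 2) ≤
      √(1 + S ^ 2) * ∑ i, √((u i - a) ^ 2 + (v i - b) ^ 2) := by
  have hLab : √(a ^ 2 + b ^ 2) ≤ a + b := by
    simpa [abs_of_nonneg ha, abs_of_nonneg hb] using Real.sqrt_sq_add_sq_le_abs_add_abs a b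
  have haL : a ≤ √(a ^ 2 + b ^ 2) := Real.le_sqrt_of_sq_le (by nlinarith)
  have hbL : b ≤ √(a ^ 2 + b ^ 2) := Real.le_sqrt_of_sq_le (by nlinarith)
  have hD := fun u v (hu : u ≤ 0) (hv : v ≤ 0) => norm_le_of_nonpos (S := S) hu hv ha hb
  have hA := fun u v => Real.sqrt_sq_add_sq_le_add u v a b
  set L := √(a ^ 2 + b ^ 2)
  obtain ⟨α, β, hα, hβ, hαβ, hαB, hβC⟩ : ∃ α β : ℝ, 0 ≤ α ∧ 0 ≤ β ∧ α + β = L * (S + 1) ∧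
      α ≤ L - b + S * a ∧ β ≤ L - a + S * b := by
    rcases le_total (L - b + S * a) (L * (S + 1)) with h | h
    · exact ⟨L - b + S * a, L * (S + 1) - (L - b + S * a), by nlinarith, by linarith, by ring,
        le_rfl, by nlinarith⟩
    · exact ⟨L * (S + 1), 0, by nlinarith, le_rfl, by ring, h, by nlinarith⟩
  have hR : 1 ≤ √(1 + S ^ 2) := Real.le_sqrt_of_sq_le (by nlinarith)
  have key : ∀ i, √(u i ^ 2 + v i ^ 2) ≤ √(1 + S ^ 2) * √((u i - a) ^ 2 + (v i - b) ^ 2) +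
      (L - α * (if u i ≤ 0 then 1 else 0) - β * (if v i ≤ 0 then 1 else 0)) := by
    intro i
    split_ifs with h1 h2 h2
    · linarith [hD _ _ h1 h2]
    · linarith [norm_le_of_fst_nonpos a b hS h1 (not_le.1 h2).le]
    · have h := norm_le_of_fst_nonpos b a hS h2 (not_le.1 h1).le
      rw [add_comm (v i ^ 2), add_comm ((v i - b) ^ 2)] at h
      linarith
    · nlinarith [hA (u i) (v i), Real.sqrt_nonneg ((u i - a) ^ 2 + (v i - b) ^ 2)]
  have hsum := Finset.sum_le_sum fun i (_ : i ∈ Finset.univ) => key i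
  simp only [Finset.sum_add_distrib, Finset.sum_sub_distrib, ← Finset.mul_sum,
    Finset.sum_boole, Finset.sum_const, Finset.card_univ, nsmul_eq_mul] at hsum
  have h1 := mul_le_mul_of_nonneg_left hu hα
  have h2 := mul_le_mul_of_nonneg_left hv hβ
  have h3 : (Fintype.card ι : ℝ) * L ≤ α * (Finset.univ.filter fun i => u i ≤ 0).card +
      β * (Finset.univ.filter fun i => v i ≤ 0).card := by
    refine le_of_mul_le_mul_right ?_ (show 0 < S + 1 by linarith)
    linear_combination h1 + h2 - (Fintype.card ι : ℝ) * hαβ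
  linarith

theorem countP_ofFn_add_replicate_le {n : ℕ} (f : Fin n → ℝ) (k : ℕ) (z : ℝ) (p : ℝ → Prop)
    [DecidablePred p] :
    ((↑(List.ofFn f) : Multiset ℝ) + Multiset.replicate k z).countP p ≤
      (Finset.univ.filter fun i => p (f i)).card + k := by
  have h := Multiset.countP_le_card (p := p) (Multiset.replicate k z)
  rw [Multiset.card_replicate] at h
  rw [Multiset.countP_add, ← Fin.univ_val_map, Multiset.countP_map]
  exact Nat.add_le_add_left h _

/-- On the side of the median opposite to any given point `z`, measured by a suitable sign `σ`,
lie at least `(n - k) / 2` of the reports. -/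
theorem exists_sign_card_le {n : ℕ} (f : Fin n → ℝ) (k : ℕ) (w m z : ℝ)
    (hm : m = lowerMedian ((↑(List.ofFn f) : Multiset ℝ) + Multiset.replicate k w)) :
    ∃ σ : ℝ, σ ^ 2 = 1 ∧ 0 ≤ σ * (z - m) ∧
      n ≤ 2 * (Finset.univ.filter fun i => σ * (f i - m) ≤ 0).card + k := by
  set s := (↑(List.ofFn f) : Multiset ℝ) + Multiset.replicate k w with hs
  have hcard : s.card = n + k := by simp [hs]
  rcases le_total m z with h | h
  · refine ⟨1, by norm_num, by linarith, ?_⟩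
    have h1 := card_le_two_mul_countP_le_lowerMedian s
    have h2 := countP_ofFn_add_replicate_le f k w (· ≤ m)
    rw [← hs] at h2
    rw [← hm] at h1
    simp only [one_mul, sub_nonpos]
    omega
  · refine ⟨-1, by norm_num, by linarith, ?_⟩
    have h1 := card_le_two_mul_countP_lowerMedian_le s
    have h2 := countP_ofFn_add_replicate_le f k w (m ≤ ·)
    rw [← hs] at h2
    rw [← hm] at h1
    simp only [neg_one_mul, neg_sub, sub_nonpos]
    omega

/-- CMP with confidence c is √(2c² + 2)/(1 − c)-robust for the
utilitarian objective. -/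
theorem CMP_robustness (n : ℕ) (hn : 1 ≤ n) (c : ℝ) (hc0 : 0 ≤ c) (hc1 : c < 1)
    (k : ℕ) (hk : (k : ℝ) = c * n)
    (P : Fin n → ℝ × ℝ) (oh : ℝ × ℝ) :
    Cu (CMP P oh k) P ≤ (Real.sqrt (2 * c ^ 2 + 2) / (1 - c)) * ⨅ y : ℝ × ℝ, Cu y P := by
  have hc : 0 < 1 - c := by linarith
  have hR : √(2 * c ^ 2 + 2) / (1 - c) = √(1 + ((1 + c) / (1 - c)) ^ 2) := by
    rw [← Real.sqrt_sq hc.le, ← Real.sqrt_div (by positivity), Real.sqrt_sq hc.le]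
    congr 1
    field_simp
    ring
  have hS : 1 ≤ (1 + c) / (1 - c) := by rw [le_div_iff₀ hc]; linarith
  have hcard : ∀ q : ℕ, n ≤ 2 * q + k →
      (Fintype.card (Fin n) : ℝ) ≤ ((1 + c) / (1 - c) + 1) * q := by
    intro q hq
    have hq' : (n : ℝ) ≤ 2 * q + k := by exact_mod_cast hq
    have : (1 + c) / (1 - c) + 1 = 2 / (1 - c) := by field_simp; ring
    rw [Fintype.card_fin, this, div_mul_eq_mul_div, le_div_iff₀ hc]
    linarith
  rw [hR, Real.mul_iInf_of_nonneg (Real.sqrt_nonneg _)]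
  refine le_ciInf fun o => ?_
  obtain ⟨σ, hσ, hσo, hσn⟩ :=
    exists_sign_card_le (fun i => (P i).1) k oh.1 (CMP P oh k).1 o.1 rfl
  obtain ⟨τ, hτ, hτo, hτn⟩ :=
    exists_sign_card_le (fun i => (P i).2) k oh.2 (CMP P oh k).2 o.2 rfl
  have h := sum_norm_le_of_card_nonpos hS _ _ hσo hτo (hcard _ hσn) (hcard _ hτn)
  simp only [← mul_sub, sub_sub_sub_cancel_right, mul_pow, hσ, hτ, one_mul] at h
  simp only [Cu, eudist, ← mul_div_assoc]
  gcongr ?_ / _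
  simpa only [sub_sq_comm (_ : ℝ × ℝ).1 (P _).1, sub_sq_comm (_ : ℝ × ℝ).2 (P _).2] using h
end

section
/- Fix c ∈ [0,1) and a positive integer n such that (1+c)n/4 and cn are integers. Let P be the profile of n points in ℝ² consisting of (1+c)n/4 points at (−(1+c)/(1−c), 0), (1+c)n/4 points at ((1+c)/(1−c), 0), and (1−c)n/2 points at (0,1). Then: (i) (0,1) minimizes the utilitarian social cost C^u(·, P); (ii) CMP(P, (0,1), c) = (0,0); and (iii) C^u((0,0), P) / C^u((0,1), P) = √(2c² + 2)/(1 + c). Hence CMP with confidence c has consistency at least √(2c² + 2)/(1 + c) for the utilitarian objective. -/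
/-- A multiset of three ordered blocks has the middle block's value as its lower median when the
median position falls in that block. -/
theorem lowerMedian_replicate_add_add {x y z : ℝ} (hxy : x ≤ y) (hyz : y ≤ z) {p q r : ℕ}
    (hp : p < (p + q + r + 1) / 2) (hq : (p + q + r + 1) / 2 ≤ p + q) :
    lowerMedian (Multiset.replicate p x + Multiset.replicate q y + Multiset.replicate r z) = y := by
  have hs : Multiset.replicate p x + Multiset.replicate q y + Multiset.replicate r z =
      (↑(List.replicate p x ++ (List.replicate q y ++ List.replicate r z)) : Multiset ℝ) := by
    simp only [← Multiset.coe_replicate, Multiset.coe_add, List.append_assoc]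
  have hl : (List.replicate p x ++ (List.replicate q y ++ List.replicate r z)).Pairwise
      (· ≤ ·) := by
    simp only [List.pairwise_append, List.pairwise_replicate, List.mem_replicate, List.mem_append]
    grind
  have hsort : (Multiset.replicate p x + Multiset.replicate q y + Multiset.replicate r z).sort
      (· ≤ ·) = List.replicate p x ++ (List.replicate q y ++ List.replicate r z) := by
    rw [hs]
    exact List.Perm.eq_of_pairwise' (Multiset.pairwise_sort _ _) hl
      (Multiset.coe_eq_coe.mp (Multiset.sort_eq _ _))
  rw [lowerMedian, hsort]
  simp only [Multiset.card_add, Multiset.card_replicate]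
  rw [List.getD_append_right _ _ _ _ (by simp; omega),
    List.getD_append _ _ _ _ (by simp; omega), List.getD_replicate _ (by simp; omega)]

/-- A finite family whose values lie among three distinct points is, as a multiset, determined by
the sizes of its fibres. -/
theorem map_univ_eq_replicate_add_add {ι α : Type*} [Fintype ι] {P : ι → α} {x y z : α}
    (hxy : x ≠ y) (hxz : x ≠ z) (hyz : y ≠ z) (h : ∀ i, P i = x ∨ P i = y ∨ P i = z) :
    (Finset.univ : Finset ι).val.map P =
      Multiset.replicate (Nat.card {i // P i = x}) x +
      Multiset.replicate (Nat.card {i // P i = y}) y +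
      Multiset.replicate (Nat.card {i // P i = z}) z := by
  classical
  have hcount : ∀ w, ((Finset.univ : Finset ι).val.map P).count w = Nat.card {i // P i = w} := by
    intro w
    rw [Multiset.count_map, Nat.card_eq_fintype_card, Fintype.card_subtype, Finset.card_def,
      Finset.filter_val]
    simp only [eq_comm]
  ext w
  simp only [Multiset.count_add, Multiset.count_replicate]
  by_cases hx : x = w
  · subst hx; simp [hcount, hxy.symm, hxz.symm]
  by_cases hy : y = w
  · subst hy; simp [hcount, hx, hyz.symm]
  by_cases hz : z = w
  · subst hz; simp [hcount, hx, hy]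
  simp only [hx, hy, hz, if_false, add_zero, Multiset.count_eq_zero, Multiset.mem_map]
  rintro ⟨i, -, rfl⟩
  rcases h i with h | h | h
  exacts [hx h.symm, hy h.symm, hz h.symm]

/-- The lower bound on distances obtained from the Cauchy-Schwarz inequality. -/
theorem le_eudist_mul_sqrt (y p v : ℝ × ℝ) :
    (y.1 - p.1) * v.1 + (y.2 - p.2) * v.2 ≤ eudist y p * √(v.1 ^ 2 + v.2 ^ 2) := by
  rw [eudist, ← Real.sqrt_mul (by positivity)]
  apply Real.le_sqrt_of_sq_le
  nlinarith [sq_nonneg ((y.1 - p.1) * v.2 - (y.2 - p.2) * v.1)]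

/-- The apex of an isosceles triangle minimizes the weighted sum of distances to the vertices when
its weight is large enough. -/
theorem apex_minimizes_weighted_dist {t α β : ℝ} (hα : 0 ≤ α)
    (hαβ : 2 * α ≤ β * √(t ^ 2 + 1)) (y : ℝ × ℝ) :
    2 * α * √(t ^ 2 + 1) ≤
      α * eudist y (-t, 0) + α * eudist y (t, 0) + β * eudist y (0, 1) := by
  have hs : 0 < √(t ^ 2 + 1) := by positivity
  have hs2 : √(t ^ 2 + 1) ^ 2 = t ^ 2 + 1 := Real.sq_sqrt (by positivity)
  have h1 := le_eudist_mul_sqrt y (-t, 0) (t, 1)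
  have h2 := le_eudist_mul_sqrt y (t, 0) (-t, 1)
  have h3 := le_eudist_mul_sqrt y (0, 1) (0, -1)
  have h4 : 0 ≤ eudist y (0, 1) := Real.sqrt_nonneg _
  norm_num at h1 h2 h3
  have h5 := mul_le_mul_of_nonneg_right hαβ h4
  refine le_of_mul_le_mul_right ?_ hs
  nlinarith [mul_le_mul_of_nonneg_left h1 hα, mul_le_mul_of_nonneg_left h2 hα,
    mul_le_mul_of_nonneg_left h3 hα]


/-- the consistency lower-bound instance for CMP: on the profile
with (1+c)n/4 points at (−(1+c)/(1−c), 0), (1+c)n/4 points at ((1+c)/(1−c), 0)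
and (1−c)n/2 points at (0,1), the point (0,1) is optimal, CMP with the correct
prediction outputs (0,0), and the resulting ratio is √(2c²+2)/(1+c). -/
theorem CMP_consistency_lower_bound_instance (c : ℝ) (hc0 : 0 ≤ c) (hc1 : c < 1)
    (n : ℕ) (hn : 0 < n) (k : ℕ) (hk : (k : ℝ) = c * n)
    (a b : ℕ) (ha : (a : ℝ) = (1 + c) * n / 4) (hb : (b : ℝ) = (1 - c) * n / 2)
    (P : Fin n → ℝ × ℝ)
    (hall : ∀ i, P i = (-((1 + c) / (1 - c)), 0) ∨ P i = ((1 + c) / (1 - c), 0) ∨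
      P i = (0, 1))
    (hL : Nat.card {i : Fin n // P i = (-((1 + c) / (1 - c)), 0)} = a)
    (hR : Nat.card {i : Fin n // P i = ((1 + c) / (1 - c), 0)} = a)
    (hU : Nat.card {i : Fin n // P i = (0, 1)} = b) :
    (∀ y : ℝ × ℝ, Cu (0, 1) P ≤ Cu y P) ∧
    CMP P (0, 1) k = (0, 0) ∧
    Cu (0, 0) P / Cu (0, 1) P = Real.sqrt (2 * c ^ 2 + 2) / (1 + c) := by
  set t := (1 + c) / (1 - c) with ht
  have hc : 0 < 1 - c := by linarith
  have htpos : 0 < t := by positivity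
  have hnR : (0 : ℝ) < n := by exact_mod_cast hn
  have hmap := map_univ_eq_replicate_add_add (P := P) (x := (-t, 0)) (y := (t, 0)) (z := (0, 1))
    (by simp only [ne_eq, Prod.mk.injEq]; intro h; linarith [h.1]) (by simp) (by simp) hall
  rw [hL, hR, hU] at hmap
  have hsum : ∀ y, ∑ i, eudist y (P i) =
      a * eudist y (-t, 0) + a * eudist y (t, 0) + b * eudist y (0, 1) := by
    intro y
    have h := congrArg (fun s => (s.map (eudist y)).sum) hmap
    simpa [Multiset.map_map, Finset.sum, Function.comp_def] using h
  have hcoord : ∀ f : ℝ × ℝ → ℝ, (↑(List.ofFn fun i => f (P i)) : Multiset ℝ) =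
      Multiset.replicate a (f (-t, 0)) + Multiset.replicate a (f (t, 0)) +
      Multiset.replicate b (f (0, 1)) := by
    intro f
    have h := congrArg (Multiset.map f) hmap
    simpa [Multiset.map_map, Function.comp_def] using h
  have hs : √(t ^ 2 + 1) = √(2 * c ^ 2 + 2) / (1 - c) := by
    have h : t ^ 2 + 1 = (2 * c ^ 2 + 2) / (1 - c) ^ 2 := by
      rw [ht]
      field_simp
      ring
    rw [h, Real.sqrt_div (by positivity), Real.sqrt_sq hc.le]
  have hr2 : √(2 * c ^ 2 + 2) ^ 2 = 2 * c ^ 2 + 2 := Real.sq_sqrt (by positivity)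
  have hrpos : 0 < √(2 * c ^ 2 + 2) := by positivity
  have hopt : ∑ i, eudist (0, 1) (P i) = 2 * a * √(t ^ 2 + 1) := by
    rw [hsum]
    simp only [eudist]
    norm_num
    ring
  refine ⟨fun y => ?_, ?_, ?_⟩
  · rw [Cu, Cu, hopt, hsum]
    refine div_le_div_of_nonneg_right (apex_minimizes_weighted_dist (by positivity) ?_ y) hnR.le
    have h1 : 1 + c ≤ √(2 * c ^ 2 + 2) := by
      apply Real.le_sqrt_of_sq_le
      nlinarith [sq_nonneg (1 - c)]
    have h2 : (b : ℝ) * √(t ^ 2 + 1) = n * √(2 * c ^ 2 + 2) / 2 := by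
      rw [hs, hb]
      field_simp
    rw [h2, ha]
    nlinarith
  · have hbpos : 0 < b := by
      have : (0 : ℝ) < b := by rw [hb]; positivity
      exact_mod_cast this
    have hbk : b + k = 2 * a := by
      have : (b : ℝ) + k = 2 * a := by rw [ha, hb, hk]; ring
      exact_mod_cast this
    rw [CMP, hcoord Prod.fst, hcoord Prod.snd]
    congr 1
    · rw [show Multiset.replicate a (-t) + Multiset.replicate a t + Multiset.replicate b 0 +
          Multiset.replicate k 0 = Multiset.replicate a (-t) + Multiset.replicate (b + k) 0 +
          Multiset.replicate a t by rw [Multiset.replicate_add]; abel]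
      apply lowerMedian_replicate_add_add (by linarith) htpos.le <;> omega
    · rw [show Multiset.replicate a (0 : ℝ) + Multiset.replicate a 0 + Multiset.replicate b 1 +
          Multiset.replicate k 1 = Multiset.replicate 0 0 + Multiset.replicate (a + a) 0 +
          Multiset.replicate (b + k) 1 by simp only [Multiset.replicate_add]; simp [add_assoc]]
      apply lowerMedian_replicate_add_add le_rfl zero_le_one <;> omega
  · have horigin : ∑ i, eudist (0, 0) (P i) = 2 * a * t + b := by
      rw [hsum]
      simp only [eudist]
      norm_num
      rw [Real.sqrt_sq htpos.le]
      ring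
    rw [Cu, Cu, horigin, hopt, hs, ha, hb, ht, div_div_div_cancel_right₀ hnR.ne']
    set r := √(2 * c ^ 2 + 2)
    field_simp
    linear_combination -4 * hr2
end

section
/- Fix c ∈ [0,1) and a positive integer n such that (1−c)n/4 and cn are integers. Let Q be the profile of n points in ℝ² consisting of (1−c)n/4 points at (−(1−c)/(1+c), 0), (1−c)n/4 points at ((1−c)/(1+c), 0), and (1+c)n/2 points at (0,1). Then: (i) (0,1) minimizes the utilitarian social cost C^u(·, Q); (ii) CMP(Q, (0,0), c) = (0,0); and (iii) C^u((0,0), Q) / C^u((0,1), Q) = √(2c² + 2)/(1 − c). Hence CMP with confidence c has robustness at least √(2c² + 2)/(1 − c) for the utilitarian objective. -/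
theorem lowerMedian_coe_of_sorted (l : List ℝ) (hl : l.Pairwise (· ≤ ·)) :
    lowerMedian (l : Multiset ℝ) = l.getD ((l.length + 1) / 2 - 1) 0 := by
  have h : (l : Multiset ℝ).sort (· ≤ ·) = l := by
    rw [Multiset.coe_sort]
    exact List.mergeSort_of_pairwise (by simpa using hl)
  rw [lowerMedian, h, Multiset.coe_card]

/-- If the elements equal to `v` straddle the middle, then `v` is the lower median. -/
theorem lowerMedian_replicate_add (p q s : ℕ) (u v w : ℝ) (huv : u ≤ v) (hvw : v ≤ w)
    (hp : p < (p + q + s + 1) / 2) (hs : (p + q + s + 1) / 2 ≤ p + q) :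
    lowerMedian (Multiset.replicate p u + Multiset.replicate q v + Multiset.replicate s w) = v := by
  have h : Multiset.replicate p u + Multiset.replicate q v + Multiset.replicate s w =
      ((List.replicate p u ++ (List.replicate q v ++ List.replicate s w) : List ℝ) :
        Multiset ℝ) := by
    simp only [← Multiset.coe_replicate, Multiset.coe_add, List.append_assoc]
  rw [h, lowerMedian_coe_of_sorted]
  · rw [List.getD_append_right _ _ _ _ (by simp; omega),
      List.getD_append _ _ _ _ (by simp; omega), List.getD_replicate _ (by simp; omega)]
  · simp only [List.pairwise_append, List.pairwise_replicate, List.mem_append, List.mem_replicate]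
    grind

theorem Multiset.count_map_univ_eq_natCard {ι α : Type*} [Fintype ι] [DecidableEq α]
    (f : ι → α) (x : α) :
    ((Finset.univ : Finset ι).val.map f).count x = Nat.card {i // f i = x} := by
  classical
  rw [Multiset.count_map, Nat.card_eq_fintype_card, Fintype.card_subtype, Finset.card_def,
    Finset.filter_val]
  simp only [eq_comm]

/-- A family with three distinct possible values is determined, as a multiset, by the
multiplicities of these values. -/
theorem Multiset.map_univ_eq_replicate_add {ι α : Type*} [Fintype ι] (f : ι → α)
    {x y z : α} (hxy : x ≠ y) (hxz : x ≠ z) (hyz : y ≠ z)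
    (hf : ∀ i, f i = x ∨ f i = y ∨ f i = z) :
    (Finset.univ : Finset ι).val.map f = Multiset.replicate (Nat.card {i // f i = x}) x +
      Multiset.replicate (Nat.card {i // f i = y}) y +
      Multiset.replicate (Nat.card {i // f i = z}) z := by
  classical
  ext p
  simp only [Multiset.count_add, Multiset.count_replicate]
  by_cases hx : x = p
  · subst hx
    simp [Multiset.count_map_univ_eq_natCard, hxy.symm, hxz.symm]
  by_cases hy : y = p
  · subst hy
    simp [Multiset.count_map_univ_eq_natCard, hxy, hyz.symm]
  by_cases hz : z = p
  · subst hz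
    simp [Multiset.count_map_univ_eq_natCard, hxz, hyz]
  · simp only [hx, hy, hz, if_false, add_zero, Multiset.count_eq_zero, Multiset.mem_map, not_exists,
      not_and]
    rintro i - rfl
    grind

/-- The point `(0, 1)` minimizes the weighted sum of distances to `(-r, 0)`, `(r, 0)` (weight `a`
each) and `(0, 1)` (weight at least `2 * a`). -/
theorem weighted_eudist_apex_le (r A B : ℝ) (hA : 0 ≤ A) (hAB : 2 * A ≤ B) (y : ℝ × ℝ) :
    A * eudist (0, 1) (-r, 0) + A * eudist (0, 1) (r, 0) + B * eudist (0, 1) (0, 1) ≤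
      A * eudist y (-r, 0) + A * eudist y (r, 0) + B * eudist y (0, 1) := by
  obtain ⟨u, v⟩ := y
  simp only [eudist]
  have h0 : ((0:ℝ) - 0) ^ 2 + (1 - 1) ^ 2 = 0 := by norm_num
  have h1 : ((0:ℝ) - -r) ^ 2 + (1 - 0) ^ 2 = r ^ 2 + 1 := by ring
  have h2 : ((0:ℝ) - r) ^ 2 + (1 - 0) ^ 2 = r ^ 2 + 1 := by ring
  rw [h0, h1, h2, Real.sqrt_zero]
  set D := √(r ^ 2 + 1)
  set E := √((u - 0) ^ 2 + (v - 1) ^ 2)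
  have hD2 : D ^ 2 = r ^ 2 + 1 := Real.sq_sqrt (by positivity)
  have hD : 1 ≤ D := Real.le_sqrt_of_sq_le (by nlinarith [sq_nonneg r])
  have hE : 1 - v ≤ E := Real.le_sqrt_of_sq_le (by nlinarith [sq_nonneg u])
  have hE0 : 0 ≤ E := Real.sqrt_nonneg _
  have hDne : D ≠ 0 := by positivity
  have hl : D + (r * u + (v - 1)) / D ≤ √((u - -r) ^ 2 + (v - 0) ^ 2) := by
    have : D + (r * u + (v - 1)) / D = (r * (u + r) + v) / D := by
      field_simp; rw [hD2]; ring
    rw [this]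
    apply Real.le_sqrt_of_sq_le
    rw [div_pow, hD2, div_le_iff₀ (by positivity)]
    nlinarith [sq_nonneg (r * v - (u + r))]
  have hr : D + (-r * u + (v - 1)) / D ≤ √((u - r) ^ 2 + (v - 0) ^ 2) := by
    have : D + (-r * u + (v - 1)) / D = (-r * (u - r) + v) / D := by
      field_simp; rw [hD2]; ring
    rw [this]
    apply Real.le_sqrt_of_sq_le
    rw [div_pow, hD2, div_le_iff₀ (by positivity)]
    nlinarith [sq_nonneg (r * v + (u - r))]
  have hsum : (r * u + (v - 1)) / D + (-r * u + (v - 1)) / D = -(2 * ((1 - v) / D)) := by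
    field_simp; ring
  have hED : (1 - v) / D ≤ E := by
    rw [div_le_iff₀ (by positivity)]
    nlinarith
  nlinarith [mul_le_mul_of_nonneg_left hl hA, mul_le_mul_of_nonneg_left hr hA,
    mul_le_mul_of_nonneg_left hED hA, mul_le_mul_of_nonneg_right hAB hE0,
    congrArg (A * ·) hsum]

/-- the robustness lower-bound instance for CMP: on the profile
with (1−c)n/4 points at (−(1−c)/(1+c), 0), (1−c)n/4 points at ((1−c)/(1+c), 0)
and (1+c)n/2 points at (0,1), the point (0,1) is optimal, CMP with the wrong
prediction (0,0) outputs (0,0), and the resulting ratio is √(2c²+2)/(1−c). -/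
theorem CMP_robustness_lower_bound_instance (c : ℝ) (hc0 : 0 ≤ c) (hc1 : c < 1)
    (n : ℕ) (hn : 0 < n) (k : ℕ) (hk : (k : ℝ) = c * n)
    (a b : ℕ) (ha : (a : ℝ) = (1 - c) * n / 4) (hb : (b : ℝ) = (1 + c) * n / 2)
    (Q : Fin n → ℝ × ℝ)
    (hall : ∀ i, Q i = (-((1 - c) / (1 + c)), 0) ∨ Q i = ((1 - c) / (1 + c), 0) ∨
      Q i = (0, 1))
    (hL : Nat.card {i : Fin n // Q i = (-((1 - c) / (1 + c)), 0)} = a)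
    (hR : Nat.card {i : Fin n // Q i = ((1 - c) / (1 + c), 0)} = a)
    (hU : Nat.card {i : Fin n // Q i = (0, 1)} = b) :
    (∀ y : ℝ × ℝ, Cu (0, 1) Q ≤ Cu y Q) ∧
    CMP Q (0, 0) k = (0, 0) ∧
    Cu (0, 0) Q / Cu (0, 1) Q = Real.sqrt (2 * c ^ 2 + 2) / (1 - c) := by
  have hc : 0 < 1 + c := by linarith
  have hn' : (0 : ℝ) < n := by exact_mod_cast hn
  set r := (1 - c) / (1 + c) with hr
  have hr0 : 0 < r := div_pos (by linarith) hc
  have hM := Multiset.map_univ_eq_replicate_add Q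
    (by simp only [ne_eq, Prod.mk.injEq]; grind) (by simp) (by simp) hall
  rw [hL, hR, hU] at hM
  have hcost (y : ℝ × ℝ) : Cu y Q =
      (a * eudist y (-r, 0) + a * eudist y (r, 0) + b * eudist y (0, 1)) / n := by
    have h : ∑ i, eudist y (Q i) = ((Finset.univ.val.map Q).map (eudist y)).sum := by
      rw [Multiset.map_map]; rfl
    rw [Cu, h, hM]
    simp
  have hcoord (g : ℝ × ℝ → ℝ) : (↑(List.ofFn fun i => g (Q i)) : Multiset ℝ) =
      Multiset.replicate a (g (-r, 0)) + Multiset.replicate a (g (r, 0)) +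
        Multiset.replicate b (g (0, 1)) := by
    have h : (↑(List.ofFn fun i => g (Q i)) : Multiset ℝ) = (Finset.univ.val.map Q).map g := by
      rw [Multiset.map_map, Fin.univ_val_map]; rfl
    rw [h, hM]
    simp
  have hcn : 0 ≤ c * n := by positivity
  have hb2 : b = 2 * a + k := by
    have : (b : ℝ) = 2 * a + k := by rw [hb, ha, hk]; ring
    exact_mod_cast this
  have hab : a < b := by
    have : (a : ℝ) < b := by rw [ha, hb]; linarith
    exact_mod_cast this
  refine ⟨fun y => ?_, ?_, ?_⟩
  · rw [hcost, hcost]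
    refine div_le_div_of_nonneg_right ?_ hn'.le
    exact weighted_eudist_apex_le r a b (Nat.cast_nonneg a) (by exact_mod_cast (by omega)) y
  · rw [CMP, hcoord Prod.fst, hcoord Prod.snd, Prod.mk.injEq]
    constructor
    · have h := lowerMedian_replicate_add a (b + k) a (-r) 0 r (by linarith) hr0.le
        (by omega) (by omega)
      rw [Multiset.replicate_add] at h
      convert h using 2
      ac_rfl
    · have h := lowerMedian_replicate_add 0 (a + a + k) b 0 0 1 le_rfl zero_le_one
        (by omega) (by omega)
      rw [Multiset.replicate_add, Multiset.replicate_add, Multiset.replicate_zero, zero_add] at h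
      convert h using 2
      ac_rfl
  · have hS : 0 < √(2 * c ^ 2 + 2) := by positivity
    have hS2 : √(2 * c ^ 2 + 2) ^ 2 = 2 * c ^ 2 + 2 := Real.sq_sqrt (by positivity)
    have hD : √(r ^ 2 + 1) = √(2 * c ^ 2 + 2) / (1 + c) := by
      rw [← Real.sqrt_sq hc.le, ← Real.sqrt_div' _ (by positivity), hr]
      congr 1
      field_simp
      ring
    have h1 : eudist (0, 0) (-r, 0) = r := by simp [eudist, Real.sqrt_sq hr0.le]
    have h2 : eudist (0, 0) (r, 0) = r := by simp [eudist, Real.sqrt_sq hr0.le]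
    have h3 : eudist (0, 0) (0, 1) = 1 := by simp [eudist]
    have h4 : eudist (0, 1) (-r, 0) = √(2 * c ^ 2 + 2) / (1 + c) := by
      rw [← hD]; simp [eudist]
    have h5 : eudist (0, 1) (r, 0) = √(2 * c ^ 2 + 2) / (1 + c) := by
      rw [← hD]; simp [eudist]
    have h6 : eudist (0, 1) (0, 1) = 0 := by simp [eudist]
    have h1c : 1 - c ≠ 0 := by linarith
    rw [hcost, hcost, h1, h2, h3, h4, h5, h6, ha, hb, hr]
    generalize √(2 * c ^ 2 + 2) = S at hS hS2 ⊢
    field_simp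
    linear_combination (-4 * (1 - c)) * hS2
end

section
/- Fix c ∈ [0,1). Define α(c) as the supremum of C^u((0,0), P) / C^u((0,1), P) over all profiles P of any size m with cm ∈ ℕ such that there exists x ≥ 0 with every point of P lying in {(0,1), (x,0), (−x,0)}, (0,1) minimizes C^u(·, P), and CMP(P, (0,1), c) = (0,0); define β(c) analogously with the condition CMP(P, (0,0), c) = (0,0) in place of CMP(P, (0,1), c) = (0,0). Then for every n with cn ∈ ℕ and every profile P ∈ (ℝ²)ⁿ: (i) for every minimizer o of C^u(·, P), C^u(CMP(P, o, c), P) ≤ α(c) · OPT^u(P); and (ii) for every prediction ô ∈ ℝ², C^u(CMP(P, ô, c), P) ≤ β(c) · OPT^u(P). That is, the worst case for both the consistency and the robustness of CMP is attained on Clusters-and-Opt-on-Axes instances. -/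
/-- The set of approximation ratios of CMP with confidence c on
Clusters-and-Opt-on-Axes instances with a correct prediction (consistency). -/
def consisRatios (c : ℝ) : Set ℝ :=
  { r : ℝ | ∃ (m k : ℕ) (P : Fin m → ℝ × ℝ) (x : ℝ),
      0 < m ∧ (k : ℝ) = c * m ∧ 0 ≤ x ∧
      (∀ i, P i = (0, 1) ∨ P i = (x, 0) ∨ P i = (-x, 0)) ∧
      (∀ y : ℝ × ℝ, Cu (0, 1) P ≤ Cu y P) ∧
      CMP P (0, 1) k = (0, 0) ∧
      r = Cu (0, 0) P / Cu (0, 1) P }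

/-- The set of approximation ratios of CMP with confidence c on
Clusters-and-Opt-on-Axes instances with prediction (0,0) (robustness). -/
def robustRatios (c : ℝ) : Set ℝ :=
  { r : ℝ | ∃ (m k : ℕ) (P : Fin m → ℝ × ℝ) (x : ℝ),
      0 < m ∧ (k : ℝ) = c * m ∧ 0 ≤ x ∧
      (∀ i, P i = (0, 1) ∨ P i = (x, 0) ∨ P i = (-x, 0)) ∧
      (∀ y : ℝ × ℝ, Cu (0, 1) P ≤ Cu y P) ∧
      CMP P (0, 0) k = (0, 0) ∧
      r = Cu (0, 0) P / Cu (0, 1) P }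

/-! ### Lower medians and counting -/

lemma length_filter_le_of_forall_getElem {l : List ℝ} {p : ℝ → Prop} [DecidablePred p] {j : ℕ}
    (h : ∀ i (hi : i < l.length), j ≤ i → ¬ p l[i]) :
    (l.filter p).length ≤ j := by
  have h0 : ((l.drop j).filter p).length = 0 := by
    rw [List.length_eq_zero_iff, List.filter_eq_nil_iff]
    intro a ha
    obtain ⟨i, hi, rfl⟩ := List.mem_iff_getElem.1 ha
    rw [List.getElem_drop]
    simpa using h (j + i) (by rw [List.length_drop] at hi; omega) (by omega)
  have h1 : ((l.take j).filter p).length ≤ j :=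
    (List.length_filter_le _ _).trans (by simp)
  have h2 : (l.filter p).length
      = ((l.take j).filter p).length + ((l.drop j).filter p).length := by
    conv_lhs => rw [← List.take_append_drop j l]
    rw [List.filter_append, List.length_append]
  omega

lemma le_length_filter_of_forall_getElem {l : List ℝ} {p : ℝ → Prop} [DecidablePred p] {j : ℕ}
    (hj : j ≤ l.length) (h : ∀ i (hi : i < l.length), i < j → p l[i]) :
    j ≤ (l.filter p).length := by
  have h1 : (l.take j).filter p = l.take j := by
    rw [List.filter_eq_self]
    intro a ha
    obtain ⟨i, hi, rfl⟩ := List.mem_iff_getElem.1 ha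
    rw [List.getElem_take]
    rw [List.length_take] at hi
    simpa using h i (by omega) (by omega)
  have h2 : (l.filter p).length
      = ((l.take j).filter p).length + ((l.drop j).filter p).length := by
    conv_lhs => rw [← List.take_append_drop j l]
    rw [List.filter_append, List.length_append]
  rw [h1, List.length_take] at h2
  omega

lemma card_filter_eq_length_filter_sort (s : Multiset ℝ) (p : ℝ → Prop) [DecidablePred p] :
    (s.filter p).card = ((s.sort (· ≤ ·)).filter p).length := by
  conv_lhs => rw [← Multiset.sort_eq s (· ≤ ·)]
  rw [Multiset.filter_coe, Multiset.coe_card]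

lemma lowerMedian_eq_getElem {s : Multiset ℝ} (hs : 0 < s.card) :
    lowerMedian s = (s.sort (· ≤ ·))[(s.card + 1) / 2 - 1]'(by
      rw [Multiset.length_sort]; omega) := by
  unfold lowerMedian
  rw [List.getD_eq_getElem]

lemma card_filter_lt_lowerMedian {s : Multiset ℝ} (hs : 0 < s.card) :
    2 * (s.filter (· < lowerMedian s)).card < s.card := by
  have h : (s.filter (· < lowerMedian s)).card ≤ (s.card + 1) / 2 - 1 := by
    rw [card_filter_eq_length_filter_sort]
    apply length_filter_le_of_forall_getElem
    intro i hi hij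
    rw [lowerMedian_eq_getElem hs, not_lt]
    exact (Multiset.pairwise_sort s (· ≤ ·)).rel_get_of_le (a := ⟨_, by
      rw [Multiset.length_sort]; omega⟩) (b := ⟨i, hi⟩) hij
  omega

lemma le_card_filter_le_lowerMedian {s : Multiset ℝ} (hs : 0 < s.card) :
    s.card ≤ 2 * (s.filter (· ≤ lowerMedian s)).card := by
  have h : (s.card + 1) / 2 ≤ (s.filter (· ≤ lowerMedian s)).card := by
    rw [card_filter_eq_length_filter_sort]
    apply le_length_filter_of_forall_getElem
    · rw [Multiset.length_sort]; omega
    intro i hi hij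
    rw [lowerMedian_eq_getElem hs]
    exact (Multiset.pairwise_sort s (· ≤ ·)).rel_get_of_le (a := ⟨i, hi⟩) (b := ⟨_, by
      rw [Multiset.length_sort]; omega⟩) (Nat.le_sub_one_of_lt hij)
  omega

lemma card_filter_lowerMedian_lt {s : Multiset ℝ} (hs : 0 < s.card) :
    2 * (s.filter (lowerMedian s < ·)).card ≤ s.card := by
  have h1 := le_card_filter_le_lowerMedian hs
  have h2 := Multiset.filter_add_not (· ≤ lowerMedian s) s
  simp only [not_le] at h2
  have h3 := congrArg Multiset.card h2
  rw [Multiset.card_add] at h3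
  omega

lemma lowerMedian_eq_of_card_filter {s : Multiset ℝ} {v : ℝ}
    (h1 : 2 * (s.filter (· < v)).card < s.card) (h2 : s.card ≤ 2 * (s.filter (· ≤ v)).card) :
    lowerMedian s = v := by
  have hs : 0 < s.card := by omega
  apply le_antisymm
  · by_contra! h
    have h3 := card_filter_lt_lowerMedian hs
    have h4 : (s.filter (· ≤ v)).card ≤ (s.filter (· < lowerMedian s)).card :=
      Multiset.card_le_card (Multiset.monotone_filter_right s fun _ hb => hb.trans_lt h)
    omega
  · by_contra! h
    have h3 := le_card_filter_le_lowerMedian hs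
    have h4 : (s.filter (· ≤ lowerMedian s)).card ≤ (s.filter (· < v)).card :=
      Multiset.card_le_card (Multiset.monotone_filter_right s fun _ hb => hb.trans_lt h)
    omega

lemma card_filter_ofFn_add_replicate {n : ℕ} (g : Fin n → ℝ) (k : ℕ) (v : ℝ)
    (p : ℝ → Prop) [DecidablePred p] :
    (((↑(List.ofFn g) : Multiset ℝ) + Multiset.replicate k v).filter p).card
      = (∑ i, if p (g i) then 1 else 0) + if p v then k else 0 := by
  rw [Multiset.filter_add, Multiset.card_add]
  congr 1
  · rw [← Finset.card_filter, ← Fin.univ_val_map, Multiset.filter_map, Multiset.card_map]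
    rfl
  · split_ifs with h
    · rw [Multiset.filter_eq_self.2 (fun a ha => by rwa [Multiset.eq_of_mem_replicate ha]),
        Multiset.card_replicate]
    · rw [Multiset.filter_eq_nil.2 (fun a ha => by rwa [Multiset.eq_of_mem_replicate ha]),
        Multiset.card_zero]

lemma card_ofFn_add_replicate {n : ℕ} (g : Fin n → ℝ) (k : ℕ) (v : ℝ) :
    ((↑(List.ofFn g) : Multiset ℝ) + Multiset.replicate k v).card = n + k := by
  simp

/-- After orienting a coordinate so that `o` lies on the nonnegative side of the median, at most
half of the reports and predictions lie strictly on that side. -/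
lemma exists_sign_two_mul_card_le {n : ℕ} (hn : 0 < n) (g : Fin n → ℝ) (k : ℕ) (v o : ℝ) :
    ∃ σ : ℝ, σ ^ 2 = 1 ∧
      0 ≤ σ * (o - lowerMedian ((↑(List.ofFn g) : Multiset ℝ) + Multiset.replicate k v)) ∧
      2 * ((∑ i, if 0 < σ * (g i -
          lowerMedian ((↑(List.ofFn g) : Multiset ℝ) + Multiset.replicate k v)) then 1 else 0) +
        if 0 < σ * (v - lowerMedian ((↑(List.ofFn g) : Multiset ℝ) + Multiset.replicate k v))
          then k else 0) ≤ n + k := by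
  have hs : 0 < ((↑(List.ofFn g) : Multiset ℝ) + Multiset.replicate k v).card := by
    rw [card_ofFn_add_replicate]; omega
  have h1 := card_filter_lt_lowerMedian hs
  have h2 := card_filter_lowerMedian_lt hs
  rw [card_filter_ofFn_add_replicate, card_ofFn_add_replicate] at h1 h2
  set m := lowerMedian ((↑(List.ofFn g) : Multiset ℝ) + Multiset.replicate k v)
  rcases le_total m o with h | h
  · refine ⟨1, by norm_num, by linarith, ?_⟩
    simpa only [one_mul, sub_pos] using h2
  · refine ⟨-1, by norm_num, by linarith, ?_⟩
    simp only [neg_one_mul, neg_sub, sub_pos]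
    exact h1.le

/-! ### Pointwise distance inequalities -/

lemma mul_add_mul_le_sqrt_mul_sqrt (p q x y : ℝ) :
    p * x + q * y ≤ √(p ^ 2 + q ^ 2) * √(x ^ 2 + y ^ 2) := by
  rw [← Real.sqrt_mul (by positivity)]
  apply Real.le_sqrt_of_sq_le
  nlinarith [sq_nonneg (p * y - q * x)]

lemma norm_le_of_fst_nonpos_s16 {s a b x y : ℝ} (ha : 0 ≤ a) (hb : 0 ≤ b) (hx : x ≤ 0) :
    √(x ^ 2 + y ^ 2) ≤ √(1 + s ^ 2) * √((x - a) ^ 2 + (y - b) ^ 2) + b - s * a := by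
  have hr := Real.sqrt_nonneg (x ^ 2 + y ^ 2)
  have hr2 := Real.sq_sqrt (show 0 ≤ x ^ 2 + y ^ 2 by positivity)
  set r := √(x ^ 2 + y ^ 2)
  obtain ⟨C, D, hCs, hD, hCD, hdot⟩ : ∃ C D : ℝ, s ≤ C ∧ D ≤ 1 ∧ C ^ 2 + D ^ 2 = 1 + s ^ 2 ∧
      r ≤ C * (-x) + D * y := by
    rcases hr.eq_or_lt with h | h
    · have hx0 : x = 0 := by nlinarith [sq_nonneg x, sq_nonneg y]
      have hy0 : y = 0 := by nlinarith [sq_nonneg x, sq_nonneg y]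
      exact ⟨s, 1, le_rfl, le_rfl, by ring, by rw [hx0, hy0, ← h]; simp⟩
    · have hC := Real.sq_sqrt (show 0 ≤ s ^ 2 + (x / r) ^ 2 by positivity)
      refine ⟨√(s ^ 2 + (x / r) ^ 2), y / r, Real.le_sqrt_of_sq_le (by nlinarith [sq_nonneg (x / r)]),
        ?_, ?_, ?_⟩
      · rw [div_le_one h]
        nlinarith [sq_nonneg x]
      · rw [hC, div_pow, div_pow]
        field_simp
        linarith
      · have h1 : -x / r ≤ √(s ^ 2 + (x / r) ^ 2) :=
          Real.le_sqrt_of_sq_le (by rw [neg_div, neg_sq]; nlinarith [sq_nonneg s])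
        have h2 : -x / r * (-x) + y / r * y = r := by
          field_simp
          linarith
        nlinarith
  have h := mul_add_mul_le_sqrt_mul_sqrt C (-D) (-(x - a)) (-(y - b))
  rw [neg_sq, neg_sq, neg_sq, hCD] at h
  nlinarith

lemma norm_add_le_of_nonpos_of_le_one {s a b x y : ℝ} (hs0 : 0 ≤ s) (hs1 : s ≤ 1)
    (ha : 0 ≤ a) (hb : 0 ≤ b) (hx : x ≤ 0) (hy : y ≤ 0) :
    √(x ^ 2 + y ^ 2) + s * (a + b) ≤ √(1 + s ^ 2) * √((x - a) ^ 2 + (y - b) ^ 2) := by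
  have hr := Real.sqrt_nonneg (x ^ 2 + y ^ 2)
  have hr2 := Real.sq_sqrt (show 0 ≤ x ^ 2 + y ^ 2 by positivity)
  set r := √(x ^ 2 + y ^ 2)
  obtain ⟨C, D, hC, hD, hCD, hdot⟩ : ∃ C D : ℝ, s ≤ C ∧ s ≤ D ∧ C ^ 2 + D ^ 2 ≤ 1 + s ^ 2 ∧
      r ≤ C * (-x) + D * (-y) := by
    by_cases h1 : -y ≤ s * r
    · refine ⟨1, s, hs1, le_rfl, by linarith, ?_⟩
      have hxr : -x ≤ r := by nlinarith [sq_nonneg y]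
      rcases hr.eq_or_lt with h | h
      · rw [← h]; nlinarith
      · by_contra! hlt
        nlinarith
    by_cases h2 : -x ≤ s * r
    · refine ⟨s, 1, le_rfl, hs1, by linarith, ?_⟩
      have hyr : -y ≤ r := by nlinarith [sq_nonneg x]
      rcases hr.eq_or_lt with h | h
      · rw [← h]; nlinarith
      · by_contra! hlt
        nlinarith
    push Not at h1 h2
    have h : 0 < r := by
      rcases hr.eq_or_lt with h | h
      · rw [← h] at hr2 h1; nlinarith [sq_nonneg x, sq_nonneg y]
      · exact h
    refine ⟨-x / r, -y / r, by rw [le_div_iff₀ h]; exact h2.le, by rw [le_div_iff₀ h]; exact h1.le,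
      ?_, ?_⟩
    · have : (-x / r) ^ 2 + (-y / r) ^ 2 = 1 := by
        rw [div_pow, div_pow]
        field_simp
        linarith
      nlinarith [sq_nonneg s]
    · apply le_of_eq
      field_simp
      linarith
  have h := mul_add_mul_le_sqrt_mul_sqrt C D (-(x - a)) (-(y - b))
  rw [neg_sq, neg_sq] at h
  have h3 := mul_le_mul_of_nonneg_right (Real.sqrt_le_sqrt hCD)
    (Real.sqrt_nonneg ((x - a) ^ 2 + (y - b) ^ 2))
  nlinarith

lemma norm_add_norm_le_of_nonpos {s a b x y : ℝ}
    (ha : 0 ≤ a) (hb : 0 ≤ b) (hx : x ≤ 0) (hy : y ≤ 0) :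
    √(x ^ 2 + y ^ 2) + s * √(a ^ 2 + b ^ 2)
      ≤ √(1 + s ^ 2) * √((x - a) ^ 2 + (y - b) ^ 2) := by
  have h := mul_add_mul_le_sqrt_mul_sqrt 1 s (√(x ^ 2 + y ^ 2)) (√(a ^ 2 + b ^ 2))
  rw [Real.sq_sqrt (by positivity), Real.sq_sqrt (by positivity), one_mul, one_pow] at h
  refine h.trans (mul_le_mul_of_nonneg_left (Real.sqrt_le_sqrt ?_) (Real.sqrt_nonneg _))
  nlinarith [mul_nonneg ha (neg_nonneg.2 hx), mul_nonneg hb (neg_nonneg.2 hy)]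

lemma norm_le_mul_norm_sub_add_norm (s a b x y : ℝ) :
    √(x ^ 2 + y ^ 2) ≤ √(1 + s ^ 2) * √((x - a) ^ 2 + (y - b) ^ 2) + √(a ^ 2 + b ^ 2) := by
  have h1 : √(x ^ 2 + y ^ 2) ≤ √((x - a) ^ 2 + (y - b) ^ 2) + √(a ^ 2 + b ^ 2) := by
    have h := mul_add_mul_le_sqrt_mul_sqrt (x - a) (y - b) a b
    apply Real.sqrt_le_iff.2 ⟨by positivity, ?_⟩
    rw [add_sq, Real.sq_sqrt (by positivity), Real.sq_sqrt (by positivity)]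
    nlinarith
  have h2 : 1 ≤ √(1 + s ^ 2) := Real.one_le_sqrt.2 (by nlinarith [sq_nonneg s])
  nlinarith [Real.sqrt_nonneg ((x - a) ^ 2 + (y - b) ^ 2)]

/-- Nonnegative weights `μ`, `ν` bounding the distance to the origin by the scaled distance to
`(a, b)`, up to a correction that depends only on the open half planes containing the point. -/
def IsHalfPlaneCertificate (s a b μ ν : ℝ) : Prop :=
  0 ≤ μ ∧ 0 ≤ ν ∧ ∀ x y : ℝ, √(x ^ 2 + y ^ 2) ≤ √(1 + s ^ 2) * √((x - a) ^ 2 + (y - b) ^ 2)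
    + μ * (if 0 < x then 1 else -s) + ν * (if 0 < y then 1 else -s)

lemma IsHalfPlaneCertificate.self {s a b : ℝ} (hs0 : 0 ≤ s) (hs1 : s ≤ 1)
    (ha : 0 ≤ a) (hb : 0 ≤ b) : IsHalfPlaneCertificate s a b a b := by
  refine ⟨ha, hb, fun x y => ?_⟩
  split_ifs with hx hy hy
  · have h := norm_le_mul_norm_sub_add_norm s a b x y
    have h2 : √(a ^ 2 + b ^ 2) ≤ a + b :=
      Real.sqrt_le_iff.2 ⟨by positivity, by nlinarith [mul_nonneg ha hb]⟩
    linarith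
  · have h := norm_le_of_fst_nonpos_s16 (s := s) (y := x) hb ha (not_lt.1 hy)
    rw [add_comm (y ^ 2), add_comm ((y - b) ^ 2)] at h
    linarith
  · have h := norm_le_of_fst_nonpos_s16 (s := s) (y := y) ha hb (not_lt.1 hx)
    linarith
  · have h := norm_add_le_of_nonpos_of_le_one hs0 hs1 ha hb (not_lt.1 hx) (not_lt.1 hy)
    linarith

lemma exists_isHalfPlaneCertificate {s a b : ℝ} (hs : 1 ≤ s) (ha : 0 ≤ a) (hb : 0 ≤ b) :
    ∃ μ ν, IsHalfPlaneCertificate s a b μ ν := by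
  have ht0 := Real.sqrt_nonneg (a ^ 2 + b ^ 2)
  have hat : a ≤ √(a ^ 2 + b ^ 2) := Real.le_sqrt_of_sq_le (by nlinarith [sq_nonneg b])
  have hbt : b ≤ √(a ^ 2 + b ^ 2) := Real.le_sqrt_of_sq_le (by nlinarith [sq_nonneg a])
  have hab : √(a ^ 2 + b ^ 2) ≤ a + b :=
    Real.sqrt_le_iff.2 ⟨by positivity, by nlinarith [mul_nonneg ha hb]⟩
  have hT := fun x y : ℝ => norm_le_mul_norm_sub_add_norm s a b x y
  have hU := fun (x y : ℝ) (hx : x ≤ 0) (hy : y ≤ 0) =>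
    norm_add_norm_le_of_nonpos (s := s) ha hb hx hy
  set t := √(a ^ 2 + b ^ 2)
  obtain ⟨μ, hμ⟩ : ∃ μ, μ * (1 + s) = t - b + a * s :=
    ⟨(t - b + a * s) / (1 + s), div_mul_cancel₀ _ (by positivity)⟩
  have hμ0 : 0 ≤ μ := by
    by_contra! h
    nlinarith
  have hν0 : 0 ≤ t - μ := by
    by_contra! h
    nlinarith
  refine ⟨μ, t - μ, hμ0, hν0, fun x y => ?_⟩
  split_ifs with hx hy hy
  · linarith [hT x y]
  · have h := norm_le_of_fst_nonpos_s16 (s := s) (y := x) hb ha (not_lt.1 hy)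
    rw [add_comm (y ^ 2), add_comm ((y - b) ^ 2)] at h
    nlinarith
  · have h := norm_le_of_fst_nonpos_s16 (s := s) (y := y) ha hb (not_lt.1 hx)
    nlinarith
  · have h := hU x y (not_lt.1 hx) (not_lt.1 hy)
    linarith

/-! ### Upper bounds for the mechanism -/

lemma mul_sum_ite_nonpos {n : ℕ} {s μ : ℝ} (hμ : 0 ≤ μ) (g : Fin n → ℝ)
    (h : μ ≠ 0 → (1 + s) * ((∑ i, if 0 < g i then 1 else 0 : ℕ) : ℝ) ≤ s * n) :
    ∑ i, μ * (if 0 < g i then 1 else -s) ≤ 0 := by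
  rcases eq_or_ne μ 0 with rfl | h0
  · simp
  have h1 : ∑ i, (if 0 < g i then 1 else -s)
      = (1 + s) * ((∑ i, if 0 < g i then 1 else 0 : ℕ) : ℝ) - s * n := by
    have : ∀ i, (if 0 < g i then 1 else -s)
        = (1 + s) * (((if 0 < g i then 1 else 0 : ℕ) : ℕ) : ℝ) - s := by
      intro i; split_ifs <;> simp
    rw [Finset.sum_congr rfl fun i _ => this i, Finset.sum_sub_distrib, ← Finset.mul_sum]
    simp [mul_comm]
  rw [← Finset.mul_sum, h1]
  exact mul_nonpos_of_nonneg_of_nonpos hμ (by linarith [h h0])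

lemma Cu_le_of_isHalfPlaneCertificate {n : ℕ} (P : Fin n → ℝ × ℝ) (m o : ℝ × ℝ)
    {s σ τ μ ν : ℝ} (hσ : σ ^ 2 = 1) (hτ : τ ^ 2 = 1)
    (hcert : IsHalfPlaneCertificate s (σ * (o.1 - m.1)) (τ * (o.2 - m.2)) μ ν)
    (h1 : μ ≠ 0 →
      (1 + s) * ((∑ i, if 0 < σ * ((P i).1 - m.1) then 1 else 0 : ℕ) : ℝ) ≤ s * n)
    (h2 : ν ≠ 0 →
      (1 + s) * ((∑ i, if 0 < τ * ((P i).2 - m.2) then 1 else 0 : ℕ) : ℝ) ≤ s * n) :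
    Cu m P ≤ √(1 + s ^ 2) * Cu o P := by
  obtain ⟨hμ, hν, hpt⟩ := hcert
  unfold Cu
  rw [← mul_div_assoc]
  apply div_le_div_of_nonneg_right _ (Nat.cast_nonneg n)
  have e1 : ∀ i, eudist m (P i)
      = √((σ * ((P i).1 - m.1)) ^ 2 + (τ * ((P i).2 - m.2)) ^ 2) := by
    intro i
    rw [mul_pow, mul_pow, hσ, hτ, eudist]
    congr 1; ring
  have e2 : ∀ i, eudist o (P i) = √((σ * ((P i).1 - m.1) - σ * (o.1 - m.1)) ^ 2
      + (τ * ((P i).2 - m.2) - τ * (o.2 - m.2)) ^ 2) := by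
    intro i
    rw [← mul_sub, ← mul_sub, mul_pow, mul_pow, hσ, hτ, eudist]
    congr 1; ring
  have h3 := mul_sum_ite_nonpos hμ (fun i => σ * ((P i).1 - m.1)) h1
  have h4 := mul_sum_ite_nonpos hν (fun i => τ * ((P i).2 - m.2)) h2
  calc ∑ i, eudist m (P i)
      ≤ ∑ i, (√(1 + s ^ 2) * eudist o (P i) + μ * (if 0 < σ * ((P i).1 - m.1) then 1 else -s)
          + ν * (if 0 < τ * ((P i).2 - m.2) then 1 else -s)) := by
        refine Finset.sum_le_sum fun i _ => ?_
        rw [e1, e2]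
        exact hpt _ _
    _ ≤ √(1 + s ^ 2) * ∑ i, eudist o (P i) := by
        rw [Finset.sum_add_distrib, Finset.sum_add_distrib, ← Finset.mul_sum]
        linarith

lemma Cu_CMP_le_of_prediction_eq {c : ℝ} (hc0 : 0 ≤ c) {n : ℕ}
    (hn : 0 < n) {k : ℕ} (hk : (k : ℝ) = c * n) (hc1 : c < 1) (P : Fin n → ℝ × ℝ) (o : ℝ × ℝ) :
    Cu (CMP P o k) P ≤ √(1 + ((1 - c) / (1 + c)) ^ 2) * Cu o P := by
  obtain ⟨σ, hσ, ha, hA⟩ := exists_sign_two_mul_card_le hn (fun i => (P i).1) k o.1 o.1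
  obtain ⟨τ, hτ, hb, hB⟩ := exists_sign_two_mul_card_le hn (fun i => (P i).2) k o.2 o.2
  have hs0 : 0 ≤ (1 - c) / (1 + c) := div_nonneg (by linarith) (by linarith)
  have hs1 : (1 - c) / (1 + c) ≤ 1 := by rw [div_le_one (by linarith)]; linarith
  have key : ∀ N : ℕ, 2 * (N + k) ≤ n + k →
      (1 + (1 - c) / (1 + c)) * (N : ℝ) ≤ (1 - c) / (1 + c) * n := by
    intro N hN
    have hN' : (2 * (N + k) : ℝ) ≤ n + k := by exact_mod_cast hN
    have hc : 0 < 1 + c := by linarith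
    rw [one_add_div hc.ne', div_mul_eq_mul_div, div_mul_eq_mul_div]
    apply div_le_div_of_nonneg_right _ hc.le
    rw [hk] at hN'
    linarith
  refine Cu_le_of_isHalfPlaneCertificate P (CMP P o k) o hσ hτ
    (IsHalfPlaneCertificate.self hs0 hs1 ha hb) (fun h => ?_) (fun h => ?_)
  · rw [if_pos (lt_of_le_of_ne ha h.symm)] at hA
    exact key _ hA
  · rw [if_pos (lt_of_le_of_ne hb h.symm)] at hB
    exact key _ hB

lemma Cu_CMP_le {c : ℝ} (hc0 : 0 ≤ c) {n : ℕ}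
    (hn : 0 < n) {k : ℕ} (hk : (k : ℝ) = c * n) (hc1 : c < 1) (P : Fin n → ℝ × ℝ) (q o : ℝ × ℝ) :
    Cu (CMP P q k) P ≤ √(1 + ((1 + c) / (1 - c)) ^ 2) * Cu o P := by
  obtain ⟨σ, hσ, ha, hA⟩ := exists_sign_two_mul_card_le hn (fun i => (P i).1) k q.1 o.1
  obtain ⟨τ, hτ, hb, hB⟩ := exists_sign_two_mul_card_le hn (fun i => (P i).2) k q.2 o.2
  have hc : 0 < 1 - c := by linarith
  have hs1 : 1 ≤ (1 + c) / (1 - c) := by rw [one_le_div hc]; linarith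
  have key : ∀ N M : ℕ, 2 * (N + M) ≤ n + k →
      (1 + (1 + c) / (1 - c)) * (N : ℝ) ≤ (1 + c) / (1 - c) * n := by
    intro N M hN
    have hN' : (2 * (N + M) : ℝ) ≤ n + k := by exact_mod_cast hN
    have hM : (0 : ℝ) ≤ M := Nat.cast_nonneg M
    rw [one_add_div hc.ne', div_mul_eq_mul_div, div_mul_eq_mul_div]
    apply div_le_div_of_nonneg_right _ hc.le
    rw [hk] at hN'
    linarith
  obtain ⟨μ, ν, hcert⟩ := exists_isHalfPlaneCertificate hs1 ha hb
  exact Cu_le_of_isHalfPlaneCertificate P (CMP P q k) o hσ hτ hcert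
    (fun _ => key _ _ hA) (fun _ => key _ _ hB)

/-! ### The extremal instances on clusters and optimum on axes -/

/-- `A` points at each of `(x, 0)` and `(-x, 0)`, and `B` points at `(0, 1)`. -/
def coaProfile (A B : ℕ) (x : ℝ) : Fin (A + A + B) → ℝ × ℝ :=
  Fin.append (Fin.append (fun _ : Fin A => (x, 0)) (fun _ : Fin A => (-x, 0)))
    (fun _ : Fin B => (0, 1))

lemma coaProfile_mem (A B : ℕ) (x : ℝ) (i : Fin (A + A + B)) :
    coaProfile A B x i = (0, 1) ∨ coaProfile A B x i = (x, 0) ∨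
      coaProfile A B x i = (-x, 0) := by
  unfold coaProfile
  refine Fin.addCases (fun i => ?_) (fun i => ?_) i
  · rw [Fin.append_left]
    refine Fin.addCases (fun i => ?_) (fun i => ?_) i
    · rw [Fin.append_left]; simp
    · rw [Fin.append_right]; simp
  · rw [Fin.append_right]; simp

lemma sum_coaProfile {M : Type*} [AddCommMonoid M] (A B : ℕ) (x : ℝ) (f : ℝ × ℝ → M) :
    ∑ i, f (coaProfile A B x i) = A • f (x, 0) + A • f (-x, 0) + B • f (0, 1) := by
  unfold coaProfile
  rw [Fin.sum_univ_add, Fin.sum_univ_add]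
  simp only [Fin.append_left, Fin.append_right, Finset.sum_const, Finset.card_univ, Fintype.card_fin]

lemma CMP_coaProfile {A B k : ℕ} {x v : ℝ} (hA : 0 < A) (hB : 0 < B) (hx : 0 < x) (hv : 0 ≤ v)
    (h : A + A + B + k ≤ 2 * (A + A + if v ≤ 0 then k else 0)) :
    CMP (coaProfile A B x) (0, v) k = (0, 0) := by
  unfold CMP
  have hx' : ¬ x < 0 := not_lt.2 hx.le
  refine Prod.ext (lowerMedian_eq_of_card_filter ?_ ?_) (lowerMedian_eq_of_card_filter ?_ ?_)
  · rw [card_filter_ofFn_add_replicate, card_ofFn_add_replicate,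
      sum_coaProfile A B x fun p => if p.1 < 0 then 1 else 0]
    simp [hx, hx']
    omega
  · rw [card_filter_ofFn_add_replicate, card_ofFn_add_replicate,
      sum_coaProfile A B x fun p => if p.1 ≤ 0 then 1 else 0]
    simp [hx.le, not_le.2 hx]
    omega
  · rw [card_filter_ofFn_add_replicate, card_ofFn_add_replicate,
      sum_coaProfile A B x fun p => if p.2 < 0 then 1 else 0]
    simp [not_lt.2 hv, not_lt.2 zero_le_one]
    omega
  · rw [card_filter_ofFn_add_replicate, card_ofFn_add_replicate,
      sum_coaProfile A B x fun p => if p.2 ≤ 0 then 1 else 0]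
    simpa [not_le.2 one_pos] using h

lemma Cu_coaProfile (A B : ℕ) (x : ℝ) (y : ℝ × ℝ) :
    Cu y (coaProfile A B x) = (A * √((y.1 - x) ^ 2 + y.2 ^ 2) + A * √((y.1 + x) ^ 2 + y.2 ^ 2)
      + B * √(y.1 ^ 2 + (y.2 - 1) ^ 2)) / (A + A + B : ℕ) := by
  unfold Cu
  rw [sum_coaProfile A B x fun p => eudist y p]
  simp [eudist]

lemma Cu_coaProfile_opt {A E : ℕ} (hE : 0 < E) (y : ℝ × ℝ) :
    Cu (0, 1) (coaProfile A (2 * E) (A / E)) ≤ Cu y (coaProfile A (2 * E) (A / E)) := by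
  rw [Cu_coaProfile, Cu_coaProfile]
  apply div_le_div_of_nonneg_right _ (Nat.cast_nonneg _)
  have hE' : (0 : ℝ) < E := Nat.cast_pos.2 hE
  have hA' : (0 : ℝ) ≤ A := Nat.cast_nonneg A
  obtain ⟨x, hx⟩ : ∃ x : ℝ, x = (A : ℝ) / E := ⟨_, rfl⟩
  have hAx : (A : ℝ) = x * E := by rw [hx]; field_simp
  have hx0 : 0 ≤ x := by rw [hx]; positivity
  rw [← hx]
  obtain ⟨u, v⟩ := y
  have h1 := mul_add_mul_le_sqrt_mul_sqrt (-x) 1 (u - x) v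
  have h2 := mul_add_mul_le_sqrt_mul_sqrt x 1 (u + x) v
  have h3 : |v - 1| ≤ √(u ^ 2 + (v - 1) ^ 2) := by
    rw [← Real.sqrt_sq_eq_abs]
    exact Real.sqrt_le_sqrt (by nlinarith [sq_nonneg u])
  have h4 : 1 - v ≤ |v - 1| := by rw [abs_sub_comm]; exact le_abs_self _
  have h4' := abs_nonneg (v - 1)
  have hL : x ≤ √(x ^ 2 + 1) := Real.le_sqrt_of_sq_le (by linarith)
  have hL2 := Real.sq_sqrt (show 0 ≤ x ^ 2 + 1 by positivity)
  have hL0 : 0 < √(x ^ 2 + 1) := Real.sqrt_pos.2 (by positivity)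
  have e1 : √((0 - x) ^ 2 + 1 ^ 2) = √(x ^ 2 + 1) := by congr 1; ring
  have e2 : √((0 + x) ^ 2 + 1 ^ 2) = √(x ^ 2 + 1) := by congr 1; ring
  rw [neg_sq, one_pow] at h1
  rw [one_pow] at h2
  simp only [e1, e2]
  norm_num
  set L := √(x ^ 2 + 1)
  set R1 := √((u - x) ^ 2 + v ^ 2)
  set R2 := √((u + x) ^ 2 + v ^ 2)
  set R3 := √(u ^ 2 + (v - 1) ^ 2)
  rw [hAx]
  have h5 : x * (1 - v) ≤ L * R3 :=
    calc x * (1 - v) ≤ x * |v - 1| := mul_le_mul_of_nonneg_left h4 hx0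
      _ ≤ L * |v - 1| := mul_le_mul_of_nonneg_right hL h4'
      _ ≤ L * R3 := mul_le_mul_of_nonneg_left h3 hL0.le
  have h6 : x * (2 * (x ^ 2 + v)) ≤ x * (L * (R1 + R2)) :=
    mul_le_mul_of_nonneg_left (by nlinarith) hx0
  have h7 : 2 * x * L ≤ x * (R1 + R2) + 2 * R3 := by
    refine le_of_mul_le_mul_left ?_ hL0
    nlinarith
  nlinarith

lemma Cu_coaProfile_ratio {A E : ℕ} (hA : 0 < A) (hE : 0 < E) :
    Cu (0, 0) (coaProfile A (2 * E) (A / E)) / Cu (0, 1) (coaProfile A (2 * E) (A / E))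
      = √(1 + ((E : ℝ) / A) ^ 2) := by
  have hE' : (0 : ℝ) < E := Nat.cast_pos.2 hE
  have hA' : (0 : ℝ) < A := Nat.cast_pos.2 hA
  have hm : ((A + A + 2 * E : ℕ) : ℝ) ≠ 0 := by
    have : A + A + 2 * E ≠ 0 := by omega
    exact_mod_cast this
  rw [Cu_coaProfile, Cu_coaProfile, div_div_div_cancel_right₀ hm]
  have hL0 : 0 < √(1 + ((E : ℝ) / A) ^ 2) := Real.sqrt_pos.2 (by positivity)
  have hL2 := Real.sq_sqrt (show 0 ≤ 1 + ((E : ℝ) / A) ^ 2 by positivity)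
  have e1 : √(((A : ℝ) / E) ^ 2 + 1) = A / E * √(1 + ((E : ℝ) / A) ^ 2) := by
    rw [Real.sqrt_eq_iff_mul_self_eq (by positivity) (by positivity), ← sq, mul_pow, hL2]
    field_simp
  have e2 : √(((A : ℝ) / E) ^ 2) = A / E := Real.sqrt_sq (by positivity)
  norm_num
  rw [e1, e2]
  set L := √(1 + ((E : ℝ) / A) ^ 2)
  rw [div_eq_iff (by positivity)]
  have : (A : ℝ) * (A / E * L) + A * (A / E * L) = 2 * (A ^ 2 / E) * L := by ring
  rw [this, mul_left_comm, ← sq, hL2]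
  field_simp
  ring

lemma mem_consisRatios {c : ℝ} (hc1 : c < 1) {n k : ℕ} (hn : 0 < n)
    (hk : (k : ℝ) = c * n) : √(1 + ((1 - c) / (1 + c)) ^ 2) ∈ consisRatios c := by
  have hn' : (0 : ℝ) < n := Nat.cast_pos.2 hn
  have hkn : k < n := by
    have : (k : ℝ) < n := by rw [hk]; nlinarith
    exact_mod_cast this
  obtain ⟨e, rfl⟩ := Nat.exists_eq_add_of_lt hkn
  have hx : (0 : ℝ) < ((k + e + 1 + k : ℕ) : ℝ) / ((e + 1 : ℕ) : ℝ) := by positivity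
  refine ⟨_, 4 * k, coaProfile (k + e + 1 + k) (2 * (e + 1)) _, _, by omega, ?_, hx.le,
    coaProfile_mem _ _ _, Cu_coaProfile_opt (by omega),
    CMP_coaProfile (by omega) (by omega) hx zero_le_one ?_, ?_⟩
  · push_cast at hk ⊢
    linarith
  · norm_num
    omega
  · rw [Cu_coaProfile_ratio (by omega) (by omega)]
    have h1 : ((e + 1 : ℕ) : ℝ) = ((k + e + 1 : ℕ) : ℝ) * (1 - c) := by
      push_cast at hk ⊢
      linarith
    have h2 : ((k + e + 1 + k : ℕ) : ℝ) = ((k + e + 1 : ℕ) : ℝ) * (1 + c) := by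
      push_cast at hk ⊢
      linarith
    rw [h1, h2, mul_div_mul_left _ _ hn'.ne']

lemma mem_robustRatios {c : ℝ} (hc1 : c < 1) {n k : ℕ} (hn : 0 < n)
    (hk : (k : ℝ) = c * n) : √(1 + ((1 + c) / (1 - c)) ^ 2) ∈ robustRatios c := by
  have hn' : (0 : ℝ) < n := Nat.cast_pos.2 hn
  have hkn : k < n := by
    have : (k : ℝ) < n := by rw [hk]; nlinarith
    exact_mod_cast this
  obtain ⟨e, rfl⟩ := Nat.exists_eq_add_of_lt hkn
  have hx : (0 : ℝ) < ((e + 1 : ℕ) : ℝ) / ((k + e + 1 + k : ℕ) : ℝ) := by positivity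
  refine ⟨_, 4 * k, coaProfile (e + 1) (2 * (k + e + 1 + k)) _, _, by omega, ?_, hx.le,
    coaProfile_mem _ _ _, Cu_coaProfile_opt (by omega),
    CMP_coaProfile (by omega) (by omega) hx le_rfl ?_, ?_⟩
  · push_cast at hk ⊢
    linarith
  · norm_num
    omega
  · rw [Cu_coaProfile_ratio (by omega) (by omega)]
    have h1 : ((e + 1 : ℕ) : ℝ) = ((k + e + 1 : ℕ) : ℝ) * (1 - c) := by
      push_cast at hk ⊢
      linarith
    have h2 : ((k + e + 1 + k : ℕ) : ℝ) = ((k + e + 1 : ℕ) : ℝ) * (1 + c) := by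
      push_cast at hk ⊢
      linarith
    rw [h1, h2, mul_div_mul_left _ _ hn'.ne']

lemma Cu_nonneg {n : ℕ} (y : ℝ × ℝ) (P : Fin n → ℝ × ℝ) : 0 ≤ Cu y P :=
  div_nonneg (Finset.sum_nonneg fun _ _ => Real.sqrt_nonneg _) (Nat.cast_nonneg n)

lemma bddAbove_consisRatios {c : ℝ} (hc0 : 0 ≤ c) (hc1 : c < 1) : BddAbove (consisRatios c) := by
  refine ⟨√(1 + ((1 - c) / (1 + c)) ^ 2), ?_⟩
  rintro r ⟨m, k, P, x, hm, hk, -, -, -, hP, rfl⟩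
  have h := Cu_CMP_le_of_prediction_eq hc0 hm hk hc1 P (0, 1)
  rw [hP] at h
  exact div_le_of_le_mul₀ (Cu_nonneg _ _) (Real.sqrt_nonneg _) h

lemma bddAbove_robustRatios {c : ℝ} (hc0 : 0 ≤ c) (hc1 : c < 1) : BddAbove (robustRatios c) := by
  refine ⟨√(1 + ((1 + c) / (1 - c)) ^ 2), ?_⟩
  rintro r ⟨m, k, P, x, hm, hk, -, -, -, hP, rfl⟩
  have h := Cu_CMP_le hc0 hm hk hc1 P (0, 0) (0, 1)
  rw [hP] at h
  exact div_le_of_le_mul₀ (Cu_nonneg _ _) (Real.sqrt_nonneg _) h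

/-- the worst case for both the consistency and the robustness
of CMP is attained on Clusters-and-Opt-on-Axes instances: with α(c) and β(c)
the suprema of the ratios over such instances, CMP is α(c)-consistent and
β(c)-robust. -/
theorem CMP_worst_case_on_COA (c : ℝ) (hc0 : 0 ≤ c) (hc1 : c < 1)
    (n : ℕ) (hn : 0 < n) (k : ℕ) (hk : (k : ℝ) = c * n) (P : Fin n → ℝ × ℝ) :
    (∀ o : ℝ × ℝ, (∀ y : ℝ × ℝ, Cu o P ≤ Cu y P) →
      Cu (CMP P o k) P ≤ sSup (consisRatios c) * Cu o P) ∧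
    (∀ oh : ℝ × ℝ,
      Cu (CMP P oh k) P ≤ sSup (robustRatios c) * ⨅ y : ℝ × ℝ, Cu y P) := by
  refine ⟨fun o _ => ?_, fun oh => ?_⟩
  · exact (Cu_CMP_le_of_prediction_eq hc0 hn hk hc1 P o).trans
      (mul_le_mul_of_nonneg_right (le_csSup (bddAbove_consisRatios hc0 hc1)
        (mem_consisRatios hc1 hn hk)) (Cu_nonneg o P))
  · have h : Cu (CMP P oh k) P ≤ √(1 + ((1 + c) / (1 - c)) ^ 2) * ⨅ y : ℝ × ℝ, Cu y P := by
      rw [Real.mul_iInf_of_nonneg (Real.sqrt_nonneg _)]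
      exact le_ciInf fun o => Cu_CMP_le hc0 hn hk hc1 P oh o
    exact h.trans (mul_le_mul_of_nonneg_right (le_csSup (bddAbove_robustRatios hc0 hc1)
      (mem_robustRatios hc1 hn hk)) (Real.iInf_nonneg fun y => Cu_nonneg y P))
end
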